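/- arXiv:1004.2756 — 4 statements merged into one kernel-verified Lean document; each statement's English description precedes it below -/
import Mathlib

section
/- Let n ≥ 1 and let a₀, a₁, …, aₙ be real constants. If φ = φ(t,x) solves the Cauchy problem φ_tt − Δφ = Σ_{j=0}^n a_j ∂_j f_j on [0,T] × ℝⁿ with zero initial data φ(0,·) = φ_t(0,·) = 0 (where ∂₀ = ∂_t and ∂_j = ∂_{x_j} for 1 ≤ j ≤ n), then there is a constant C such that for all t ∈ [0,T], ‖φ(t,·)‖_{L²(ℝⁿ)} ≤ C(Σ_{j=0}^n ∫₀ᵗ ‖f_j(τ,·)‖_{L²(ℝⁿ)} dτ + ‖f₀(0,·)‖_{L²(ℝⁿ)}). -/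
open MeasureTheory Real NNReal ENNReal

noncomputable section

/-- Partial derivative in the `i`-th coordinate direction. -/
def pd {n : ℕ} (i : Fin n) (f : (Fin n → ℝ) → ℝ) : (Fin n → ℝ) → ℝ :=
  fun y => fderiv ℝ f y (Pi.single i 1)

/-- Euclidean norm on `ℝⁿ`. -/
def rnorm {n : ℕ} (x : Fin n → ℝ) : ℝ := Real.sqrt (∑ i, x i ^ 2)

/-- Laplacian. -/
def lap {n : ℕ} (g : (Fin n → ℝ) → ℝ) : (Fin n → ℝ) → ℝ := fun x => ∑ i, pd i (pd i g) x

/-- time derivative of a time-dependent function -/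
def dt {α : Type*} (u : ℝ → α → ℝ) : ℝ → α → ℝ := fun t x => deriv (fun s => u s x) t

/-- Wave operator on spacetime `ℝ^{1+n}` (coordinate `0` is time). -/
def waveOp {n : ℕ} (f : (Fin (n+1) → ℝ) → ℝ) : (Fin (n+1) → ℝ) → ℝ :=
  fun y => pd 0 (pd 0 f) y - ∑ i : Fin n, pd i.succ (pd i.succ f) y

/-- Index type for the Klainerman vector fields: coordinate derivatives `∂_i`,
the scaling field `L₀`, rotations `Ω_{ij}` (`1 ≤ i < j ≤ n`), and boosts `Ω_{0i}`. -/
abbrev VFIdx (n : ℕ) := (Fin (n+1)) ⊕ (Unit ⊕ (({p : Fin n × Fin n // p.1 < p.2}) ⊕ Fin n))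

/-- The Klainerman vector fields, acting on functions on spacetime `ℝ^{1+n}`. -/
def vf {n : ℕ} : VFIdx n → ((Fin (n+1) → ℝ) → ℝ) → (Fin (n+1) → ℝ) → ℝ
  | Sum.inl i => fun f y => pd i f y
  | Sum.inr (Sum.inl _) => fun f y => ∑ i, y i * pd i f y
  | Sum.inr (Sum.inr (Sum.inl p)) => fun f y =>
      y p.1.1.succ * pd p.1.2.succ f y - y p.1.2.succ * pd p.1.1.succ f y
  | Sum.inr (Sum.inr (Sum.inr i)) => fun f y => y 0 * pd i.succ f y + y i.succ * pd 0 f y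

/-- `Z^I`: composition of the Klainerman vector fields indexed by the word `I`. -/
def Zpow {n l : ℕ} (I : Fin l → VFIdx n) (f : (Fin (n+1) → ℝ) → ℝ) :
    (Fin (n+1) → ℝ) → ℝ :=
  (List.ofFn I).foldr vf f

/-- `L^p` norm of the time-`t` slice of a spacetime function. -/
def sliceNorm {n : ℕ} (f : (Fin (n+1) → ℝ) → ℝ) (t : ℝ) (p : ℝ≥0∞) : ℝ≥0∞ :=
  eLpNorm (fun x : Fin n → ℝ => f (Fin.cons t x)) p volume

/-! ### Abstract leapfrog scheme -/
section leap
variable {H : Type*} [SeminormedAddCommGroup H] [InnerProductSpace ℝ H]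

def psi (A : H →ₗ[ℝ] H) (g : H) : ℕ → H
  | 0 => 0
  | 1 => g
  | (k+2) => (2:ℝ) • psi A g (k+1) - psi A g k - A (psi A g (k+1))

theorem psi_rec (A : H →ₗ[ℝ] H) (g : H) (k : ℕ) :
    psi A g (k+2) = (2:ℝ) • psi A g (k+1) - psi A g k - A (psi A g (k+1)) := by
  rw [psi]

theorem psi_energy (A : H →ₗ[ℝ] H) (hA : ∀ u v, inner ℝ (A u) v = inner ℝ u (A v)) (g : H) (k : ℕ) :
    ‖psi A g (k+1) - psi A g k‖^2 + inner ℝ (A (psi A g (k+1))) (psi A g k) = ‖g‖^2 := by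
  induction k with
  | zero => simp [psi]
  | succ k ih =>
    rw [← ih, psi_rec]
    generalize psi A g (k+1) = u
    generalize psi A g k = v
    simp only [← real_inner_self_eq_norm_sq, map_sub, map_smul, inner_sub_left, inner_sub_right,
      inner_smul_left, inner_smul_right, hA]
    simp only [real_inner_comm u v, real_inner_comm (A u) u, real_inner_comm (A u) v,
      real_inner_comm (A v) u, ← hA, conj_trivial]
    have e1 := hA v u
    have e2 := real_inner_comm (A u) v
    simp only [real_inner_comm] at *
    linarith

theorem quad_par (A : H →ₗ[ℝ] H) (u v : H) :
    inner ℝ (A (u + v)) (u + v) + inner ℝ (A (u - v)) (u - v)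
      = 2 * inner ℝ (A u) u + 2 * inner ℝ (A v) v := by
  simp only [map_sub, map_add, inner_sub_left, inner_sub_right, inner_add_left, inner_add_right]
  ring

theorem quad_pol (A : H →ₗ[ℝ] H) (hA : ∀ u v, inner ℝ (A u) v = inner ℝ u (A v)) (u v : H) :
    inner ℝ (A (u + v)) (u + v) - inner ℝ (A (u - v)) (u - v)
      = 4 * inner ℝ (A u) v := by
  have : inner ℝ (A v) u = inner ℝ (A u) v := by rw [hA, real_inner_comm]
  simp only [map_sub, map_add, inner_sub_left, inner_sub_right, inner_add_left, inner_add_right, this]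
  ring

theorem psi_bounds (A : H →ₗ[ℝ] H) (hA : ∀ u v, inner ℝ (A u) v = inner ℝ u (A v))
    (h0 : ∀ u, 0 ≤ inner ℝ (A u) u) (h1 : ∀ u, inner ℝ (A u) u ≤ ‖u‖^2) (g : H) (k : ℕ) :
    ‖psi A g (k+1) - psi A g k‖ ≤ 2 * ‖g‖ ∧ inner ℝ (A (psi A g k)) (psi A g k) ≤ 4 * ‖g‖^2 := by
  have E := psi_energy A hA g k
  generalize psi A g (k+1) = u at *
  generalize psi A g k = v at *
  have p1 := quad_pol A hA u v
  have p2 := quad_par A (u+v) (u-v)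
  have e : u + v - (u - v) = (2:ℝ) • v := by module
  rw [e] at p2
  simp only [map_smul, inner_smul_left, inner_smul_right, conj_trivial] at p2
  have a1 := h0 (u+v)
  have a2 := h1 (u-v)
  have a3 := h0 (u + v + (u - v))
  constructor
  · apply le_of_sq_le_sq _ (by positivity)
    nlinarith [sq_nonneg ‖u-v‖]
  · nlinarith [sq_nonneg ‖u-v‖]

theorem psi_norm (A : H →ₗ[ℝ] H) (hA : ∀ u v, inner ℝ (A u) v = inner ℝ u (A v))
    (h0 : ∀ u, 0 ≤ inner ℝ (A u) u) (h1 : ∀ u, inner ℝ (A u) u ≤ ‖u‖^2) (g : H) (k : ℕ) :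
    ‖psi A g k‖ ≤ 2 * k * ‖g‖ := by
  induction k with
  | zero => simp [psi]
  | succ k ih =>
    have := (psi_bounds A hA h0 h1 g k).1
    have h2 := norm_add_le (psi A g (k+1) - psi A g k) (psi A g k)
    rw [sub_add_cancel] at h2
    push_cast
    linarith

theorem tele1 (p c : ℕ → H) (M : ℕ) :
    ∑ j ∈ Finset.range M, (inner ℝ (p (j+2) - (2:ℝ) • p (j+1) + p j) (c (j+1))
      - inner ℝ (p (j+1)) (c (j+2) - (2:ℝ) • c (j+1) + c j))
    = (inner ℝ (p (M+1)) (c M) - inner ℝ (p M) (c (M+1)))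
      - (inner ℝ (p 1) (c 0) - inner ℝ (p 0) (c 1)) := by
  induction M with
  | zero => simp
  | succ M ih =>
    rw [Finset.sum_range_succ, ih]
    simp only [inner_sub_left, inner_sub_right, inner_add_left, inner_add_right,
      inner_smul_left, inner_smul_right, conj_trivial]
    ring

theorem tele2 (p c : ℕ → H) (M : ℕ) :
    ∑ j ∈ Finset.range M, (inner ℝ (p (j+2) - p (j+1)) (c (j+1))
      + inner ℝ (p (j+1)) (c (j+1) - c j))
    = inner ℝ (p (M+1)) (c M) - inner ℝ (p 1) (c 0) := by
  induction M with
  | zero => simp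
  | succ M ih =>
    rw [Finset.sum_range_succ, ih]
    simp only [inner_sub_left, inner_sub_right]
    ring

def opA {n : ℕ} (S R : Fin n → H →ₗ[ℝ] H) (l : ℝ) : H →ₗ[ℝ] H :=
  l^2 • ∑ i, ((2:ℝ) • LinearMap.id - S i - R i)

variable {n : ℕ} (S R : Fin n → H →ₗ[ℝ] H) (l : ℝ)

theorem opA_apply (u : H) : opA S R l u = l^2 • ∑ i, ((2:ℝ) • u - S i u - R i u) := by
  simp only [opA, LinearMap.smul_apply, LinearMap.sum_apply, LinearMap.sub_apply, LinearMap.id_apply]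

theorem opA_symm (hSR : ∀ i u v, inner ℝ (S i u) v = inner ℝ u (R i v)) (u v : H) :
    inner ℝ (opA S R l u) v = inner ℝ u (opA S R l v) := by
  have hRS : ∀ i u v, inner ℝ (R i u) v = inner ℝ u (S i v) := fun i u v => by
    rw [real_inner_comm, ← hSR, real_inner_comm]
  simp only [opA_apply, inner_smul_left, inner_smul_right, sum_inner, inner_sum, inner_sub_left,
    inner_sub_right, hSR, hRS, conj_trivial]
  congr 1
  apply Finset.sum_congr rfl
  intros; ring

theorem opA_quad (hSR : ∀ i u v, inner ℝ (S i u) v = inner ℝ u (R i v))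
    (hS : ∀ i u, ‖S i u‖ = ‖u‖) (hR : ∀ i u, ‖R i u‖ = ‖u‖) (u : H) :
    inner ℝ (opA S R l u) u = l^2 * ∑ i, ‖R i u - u‖^2 := by
  simp only [opA_apply, inner_smul_left, sum_inner, conj_trivial]
  congr 1
  apply Finset.sum_congr rfl
  intro i _
  rw [norm_sub_sq_real, hR]
  simp only [inner_sub_left, inner_smul_left, hSR, conj_trivial, real_inner_self_eq_norm_sq]
  rw [real_inner_comm u (R i u)]
  ring

theorem abs_res (τ h ε : ℝ) (hn : 1 ≤ n) (hτ : 0 < τ) (hh : h = 2 * n * τ) (hε : 0 ≤ ε)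
    (hSR : ∀ i u v, inner ℝ (S i u) v = inner ℝ u (R i v))
    (hS : ∀ i u, ‖S i u‖ = ‖u‖) (hR : ∀ i u, ‖R i u‖ = ‖u‖)
    (a0 : ℝ) (a : Fin n → ℝ) (p f0 : ℕ → H) (f : Fin n → ℕ → H) (g : H) (M : ℕ)
    (hp0 : p 0 = 0)
    (hp1 : |inner ℝ (p 1) (psi (opA S R (τ/h)) (τ • g) (M+1))|
      ≤ ε * τ * ‖psi (opA S R (τ/h)) (τ • g) (M+1)‖)
    (hres : ∀ j k, j + k = M → 1 ≤ k → |inner ℝ (p (j+2) - (2:ℝ) • p (j+1) + p j + opA S R (τ/h) (p (j+1))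
        - τ^2 • (a0 • (1/τ) • (f0 (j+2) - f0 (j+1)) +
          ∑ i, a i • (1/h) • (S i (f i (j+1)) - f i (j+1)))) (psi (opA S R (τ/h)) (τ • g) k)|
      ≤ ε * τ^2 * ‖psi (opA S R (τ/h)) (τ • g) k‖) :
    |inner ℝ (p (M+1)) g| ≤ ‖g‖ * (2 * ε * ((M+1)*τ) + 2 * ε * ((M+1)*τ)^2
      + 2 * (|a0| * ((M+1)*τ * ‖f0 1‖ + τ * ∑ j ∈ Finset.range (M+1), ‖f0 (j+1)‖)
        + ∑ i, |a i| * (τ * ∑ j ∈ Finset.range (M+1), ‖f i (j+1)‖))) := by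
  set A := opA S R (τ/h) with hAdef
  have hnR : (1:ℝ) ≤ n := by exact_mod_cast hn
  have hhpos : 0 < h := by rw [hh]; positivity
  have hA : ∀ u v, inner ℝ (A u) v = inner ℝ u (A v) := opA_symm S R _ hSR
  have hq := opA_quad S R (τ/h) hSR hS hR
  have h0 : ∀ u, 0 ≤ inner ℝ (A u) u := fun u => by rw [hq]; positivity
  have h1 : ∀ u, inner ℝ (A u) u ≤ ‖u‖^2 := fun u => by
    rw [hq]
    have b : ∑ i, ‖R i u - u‖^2 ≤ ∑ i : Fin n, 4 * ‖u‖^2 := by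
      apply Finset.sum_le_sum
      intro i _
      have := norm_sub_le (R i u) u
      rw [hR] at this
      nlinarith [norm_nonneg (R i u - u), norm_nonneg u]
    simp only [Finset.sum_const, Finset.card_univ, Fintype.card_fin, nsmul_eq_mul] at b
    have e : τ/h = 1/(2*n) := by rw [hh]; field_simp
    calc (τ/h)^2 * ∑ i, ‖R i u - u‖^2 ≤ (τ/h)^2 * (n * (4 * ‖u‖^2)) := by gcongr
      _ = (1/n) * ‖u‖^2 := by rw [e]; field_simp; ring
      _ ≤ 1 * ‖u‖^2 := by gcongr; rw [div_le_one (by positivity)]; exact hnR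
      _ = _ := one_mul _
  set q := psi A (τ • g) with hqdef
  set t := (M+1)*τ with ht
  have htpos : 0 < t := by positivity
  have hg : ‖τ • g‖ = τ * ‖g‖ := by rw [norm_smul, Real.norm_of_nonneg hτ.le]
  have B1 : ∀ k, ‖q (k+1) - q k‖ ≤ 2 * τ * ‖g‖ := fun k => by
    have := (psi_bounds A hA h0 h1 (τ • g) k).1
    rw [hg] at this; linarith
  have B2 : ∀ k i, ‖R i (q k) - q k‖ ≤ 2 * h * ‖g‖ := fun k i => by
    have := (psi_bounds A hA h0 h1 (τ • g) k).2
    rw [hg, hq] at this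
    have b : ‖R i (q k) - q k‖^2 ≤ ∑ i, ‖R i (q k) - q k‖^2 :=
      Finset.single_le_sum (f := fun i => ‖R i (q k) - q k‖^2) (fun _ _ => by positivity) (Finset.mem_univ i)
    apply le_of_sq_le_sq _ (by positivity)
    have c : (τ/h)^2 * ‖R i (q k) - q k‖^2 ≤ 4 * (τ * ‖g‖)^2 :=
      le_trans (by gcongr) this
    rw [div_pow, div_mul_eq_mul_div, div_le_iff₀ (by positivity)] at c
    have : 0 < τ^2 := by positivity
    nlinarith
  have B3 : ∀ k ≤ M+1, ‖q k‖ ≤ 2 * t * ‖g‖ := fun k hk => by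
    have := psi_norm A hA h0 h1 (τ • g) k
    rw [hg] at this
    refine this.trans ?_
    have : (k:ℝ) ≤ M+1 := by exact_mod_cast hk
    rw [ht]
    nlinarith [mul_nonneg hτ.le (norm_nonneg g), mul_le_mul_of_nonneg_right this (mul_nonneg hτ.le (norm_nonneg g))]
  set c : ℕ → H := fun j => q (M+1-j) with hc
  have T1 := tele1 p c M
  have T2 := tele2 f0 c M
  have cM1 : c (M+1) = 0 := by simp [hc, hqdef, psi]
  have cM : c M = τ • g := by simp [hc, hqdef, psi]
  have c0 : c 0 = q (M+1) := by simp [hc]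
  have crec : ∀ j < M, c (j+2) - (2:ℝ) • c (j+1) + c j = - A (c (j+1)) := by
    intro j hj
    obtain ⟨k, rfl⟩ : ∃ k, M = j + k + 1 := ⟨M - j - 1, by omega⟩
    have e1 : j + k + 1 + 1 - j = k + 2 := by omega
    have e2 : j + k + 1 + 1 - (j+1) = k + 1 := by omega
    have e3 : j + k + 1 + 1 - (j+2) = k := by omega
    simp only [hc, e1, e2, e3]
    rw [hqdef, psi_rec]; module
  have T1' : ∑ j ∈ Finset.range M, inner ℝ (p (j+2) - (2:ℝ) • p (j+1) + p j + A (p (j+1))) (c (j+1))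
      = τ * inner ℝ (p (M+1)) g - inner ℝ (p 1) (c 0) := by
    rw [cM, cM1, hp0] at T1
    simp only [inner_zero_left, inner_zero_right, inner_smul_right, sub_zero] at T1
    rw [← T1]
    apply Finset.sum_congr rfl
    intro j hj
    rw [crec j (Finset.mem_range.1 hj), inner_add_left, hA, inner_neg_right]
    ring
  have main : τ * inner ℝ (p (M+1)) g = inner ℝ (p 1) (c 0)
    + ∑ j ∈ Finset.range M, inner ℝ (p (j+2) - (2:ℝ) • p (j+1) + p j + A (p (j+1))
        - τ^2 • (a0 • (1/τ) • (f0 (j+2) - f0 (j+1)) +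
          ∑ i, a i • (1/h) • (S i (f i (j+1)) - f i (j+1)))) (c (j+1))
    + τ * a0 * (τ * inner ℝ (f0 (M+1)) g - inner ℝ (f0 1) (c 0)
        - ∑ j ∈ Finset.range M, inner ℝ (f0 (j+1)) (c (j+1) - c j))
    + ∑ i, τ^2 * (a i) * (1/h) * ∑ j ∈ Finset.range M, inner ℝ (f i (j+1)) (R i (c (j+1)) - c (j+1)) := by
    have T2' : τ * inner ℝ (f0 (M+1)) g - inner ℝ (f0 1) (c 0)
        - ∑ j ∈ Finset.range M, inner ℝ (f0 (j+1)) (c (j+1) - c j)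
        = ∑ j ∈ Finset.range M, inner ℝ (f0 (j+2) - f0 (j+1)) (c (j+1)) := by
      rw [Finset.sum_add_distrib, cM, inner_smul_right] at T2
      linarith
    rw [T2']
    have e : ∀ j, inner ℝ (p (j+2) - (2:ℝ) • p (j+1) + p j + A (p (j+1))
        - τ^2 • (a0 • (1/τ) • (f0 (j+2) - f0 (j+1)) +
          ∑ i, a i • (1/h) • (S i (f i (j+1)) - f i (j+1)))) (c (j+1))
        = inner ℝ (p (j+2) - (2:ℝ) • p (j+1) + p j + A (p (j+1))) (c (j+1))
          - τ * a0 * inner ℝ (f0 (j+2) - f0 (j+1)) (c (j+1))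
          - ∑ i, τ^2 * (a i) * (1/h) * inner ℝ (f i (j+1)) (R i (c (j+1)) - c (j+1)) := by
      intro j
      rw [inner_sub_left _ (τ^2 • _), inner_smul_left, inner_add_left (a0 • _), sum_inner, inner_smul_left, inner_smul_left]
      simp only [conj_trivial, inner_smul_left, inner_sub_left (S _ _), hSR, inner_sub_right]
      rw [mul_add, Finset.mul_sum, ← sub_sub]
      congr 1
      · congr 1; field_simp
      · apply Finset.sum_congr rfl; intros; ring
    simp only [e, Finset.sum_sub_distrib, T1']
    rw [Finset.sum_comm (s := Finset.range M)]
    simp only [← Finset.mul_sum]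
    ring
  have R0 : |inner ℝ (p 1) (c 0)| ≤ ε * τ * (2 * t * ‖g‖) := by
    rw [c0]; exact hp1.trans (by gcongr; exact B3 _ le_rfl)
  have R1 : |∑ j ∈ Finset.range M, inner ℝ (p (j+2) - (2:ℝ) • p (j+1) + p j + A (p (j+1))
        - τ^2 • (a0 • (1/τ) • (f0 (j+2) - f0 (j+1)) +
          ∑ i, a i • (1/h) • (S i (f i (j+1)) - f i (j+1)))) (c (j+1))|
      ≤ M * (ε * τ^2 * (2 * t * ‖g‖)) := by
    refine (Finset.abs_sum_le_sum_abs _ _).trans ?_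
    have : ∀ j ∈ Finset.range M, |inner ℝ (p (j+2) - (2:ℝ) • p (j+1) + p j + A (p (j+1))
        - τ^2 • (a0 • (1/τ) • (f0 (j+2) - f0 (j+1)) +
          ∑ i, a i • (1/h) • (S i (f i (j+1)) - f i (j+1)))) (c (j+1))| ≤ (ε * τ^2 * (2 * t * ‖g‖)) := by
      intro j hj
      have hj := Finset.mem_range.1 hj
      have e2 : M + 1 - (j+1) = M - j := by omega
      simp only [hc, e2]
      refine (hres j (M-j) (by omega) (by omega)).trans ?_
      gcongr; exact B3 _ (by omega)
    refine (Finset.sum_le_sum this).trans ?_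
    simp
  have R2 : |τ * inner ℝ (f0 (M+1)) g - inner ℝ (f0 1) (c 0)
        - ∑ j ∈ Finset.range M, inner ℝ (f0 (j+1)) (c (j+1) - c j)|
      ≤ 2 * ‖g‖ * (t * ‖f0 1‖ + τ * ∑ j ∈ Finset.range (M+1), ‖f0 (j+1)‖) := by
    have x1 : |τ * inner ℝ (f0 (M+1)) g| ≤ τ * (‖f0 (M+1)‖ * ‖g‖) := by
      rw [abs_mul, abs_of_pos hτ]; gcongr; exact abs_real_inner_le_norm _ _
    have x2 : |inner ℝ (f0 1) (c 0)| ≤ ‖f0 1‖ * (2 * t * ‖g‖) := by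
      refine (abs_real_inner_le_norm _ _).trans ?_
      rw [c0]; gcongr; exact B3 _ le_rfl
    have x3 : |∑ j ∈ Finset.range M, inner ℝ (f0 (j+1)) (c (j+1) - c j)|
        ≤ ∑ j ∈ Finset.range M, ‖f0 (j+1)‖ * (2 * τ * ‖g‖) := by
      refine (Finset.abs_sum_le_sum_abs _ _).trans (Finset.sum_le_sum ?_)
      intro j hj
      have hj := Finset.mem_range.1 hj
      refine (abs_real_inner_le_norm _ _).trans ?_
      gcongr
      have e2 : M + 1 - j = (M + 1 - (j+1)) + 1 := by omega
      simp only [hc]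
      rw [e2, norm_sub_rev]; exact B1 _
    rw [← Finset.sum_mul] at x3
    rw [Finset.sum_range_succ]
    have := abs_sub (τ * inner ℝ (f0 (M+1)) g - inner ℝ (f0 1) (c 0)) (∑ j ∈ Finset.range M, inner ℝ (f0 (j+1)) (c (j+1) - c j))
    have := abs_sub (τ * inner ℝ (f0 (M+1)) g) (inner ℝ (f0 1) (c 0))
    have : 0 ≤ τ * (‖f0 (M+1)‖ * ‖g‖) := by positivity
    linarith
  have R3 : ∀ i, |τ^2 * (a i) * (1/h) * ∑ j ∈ Finset.range M, inner ℝ (f i (j+1)) (R i (c (j+1)) - c (j+1))|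
      ≤ τ * (2 * ‖g‖ * (|a i| * (τ * ∑ j ∈ Finset.range (M+1), ‖f i (j+1)‖))) := by
    intro i
    have x3 : |∑ j ∈ Finset.range M, inner ℝ (f i (j+1)) (R i (c (j+1)) - c (j+1))|
        ≤ ∑ j ∈ Finset.range M, ‖f i (j+1)‖ * (2 * h * ‖g‖) := by
      refine (Finset.abs_sum_le_sum_abs _ _).trans (Finset.sum_le_sum ?_)
      intro j hj
      refine (abs_real_inner_le_norm _ _).trans ?_
      gcongr
      exact B2 _ _
    have x4 : ∑ j ∈ Finset.range M, ‖f i (j+1)‖ * (2 * h * ‖g‖) ≤ ∑ j ∈ Finset.range (M+1), ‖f i (j+1)‖ * (2 * h * ‖g‖) := by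
      rw [Finset.sum_range_succ]
      have : 0 ≤ ‖f i (M+1)‖ * (2 * h * ‖g‖) := by positivity
      linarith
    rw [abs_mul]
    refine (mul_le_mul_of_nonneg_left (x3.trans x4) (abs_nonneg _)).trans (le_of_eq ?_)
    rw [abs_mul, abs_mul, abs_of_pos (show 0 < τ^2 by positivity), abs_of_pos (show 0 < 1/h by positivity), ← Finset.sum_mul]
    field_simp
  have R3' : |∑ i, τ^2 * (a i) * (1/h) * ∑ j ∈ Finset.range M, inner ℝ (f i (j+1)) (R i (c (j+1)) - c (j+1))|
      ≤ τ * (2 * ‖g‖ * ∑ i, |a i| * (τ * ∑ j ∈ Finset.range (M+1), ‖f i (j+1)‖)) := by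
    refine (Finset.abs_sum_le_sum_abs _ _).trans ((Finset.sum_le_sum fun i _ => R3 i).trans (le_of_eq ?_))
    simp only [Finset.mul_sum]
  have R2' : |τ * a0 * (τ * inner ℝ (f0 (M+1)) g - inner ℝ (f0 1) (c 0)
        - ∑ j ∈ Finset.range M, inner ℝ (f0 (j+1)) (c (j+1) - c j))|
      ≤ τ * |a0| * (2 * ‖g‖ * (t * ‖f0 1‖ + τ * ∑ j ∈ Finset.range (M+1), ‖f0 (j+1)‖)) := by
    rw [abs_mul, abs_mul, abs_of_pos hτ]; gcongr
  have key : τ * |inner ℝ (p (M+1)) g| ≤ τ * (‖g‖ * (2 * ε * t + 2 * ε * t^2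
      + 2 * (|a0| * (t * ‖f0 1‖ + τ * ∑ j ∈ Finset.range (M+1), ‖f0 (j+1)‖)
        + ∑ i, |a i| * (τ * ∑ j ∈ Finset.range (M+1), ‖f i (j+1)‖)))) := by
    have : |τ * inner ℝ (p (M+1)) g| = τ * |inner ℝ (p (M+1)) g| := by
      rw [abs_mul, abs_of_pos hτ]
    rw [← this, main]
    refine (abs_add_le _ _).trans ((add_le_add ((abs_add_le _ _).trans (add_le_add ((abs_add_le _ _).trans (add_le_add R0 R1)) R2')) R3').trans ?_)
    have : M * (ε * τ^2 * (2 * t * ‖g‖)) ≤ τ * (‖g‖ * (2 * ε * t^2)) := by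
      have e : τ * (‖g‖ * (2 * ε * t^2)) = M * (ε * τ^2 * (2 * t * ‖g‖)) + ε * τ^2 * (2 * t * ‖g‖) := by
        rw [ht]; ring
      rw [e]
      have : 0 ≤ ε * τ^2 * (2 * t * ‖g‖) := by positivity
      linarith
    nlinarith
  exact le_of_mul_le_mul_left key hτ
end leap

section fspace

def L2sub (n : ℕ) : Submodule ℝ ((Fin n → ℝ) → ℝ) where
  carrier := {u | MemLp u 2 volume}
  add_mem' := fun ha hb => MemLp.add ha hb
  zero_mem' := MemLp.zero
  smul_mem' := fun c _ hx => MemLp.const_smul hx c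

def V2 (n : ℕ) : Type := L2sub n

instance (n : ℕ) : AddCommGroup (V2 n) := inferInstanceAs (AddCommGroup (L2sub n))
instance (n : ℕ) : Module ℝ (V2 n) := inferInstanceAs (Module ℝ (L2sub n))

variable {n : ℕ}

def V2.fn (u : V2 n) : (Fin n → ℝ) → ℝ := u.1

theorem V2.mem (u : V2 n) : MemLp u.fn 2 volume := u.2

def V2.mk (u : (Fin n → ℝ) → ℝ) (h : MemLp u 2 volume) : V2 n := ⟨u, h⟩

@[simp] theorem V2.fn_mk (u : (Fin n → ℝ) → ℝ) (h : MemLp u 2 volume) : (V2.mk u h).fn = u := rfl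
@[simp] theorem V2.fn_add (u v : V2 n) (x) : (u + v).fn x = u.fn x + v.fn x := rfl
@[simp] theorem V2.fn_sub (u v : V2 n) (x) : (u - v).fn x = u.fn x - v.fn x := rfl
@[simp] theorem V2.fn_smul (c : ℝ) (u : V2 n) (x) : (c • u).fn x = c * u.fn x := rfl
@[simp] theorem V2.fn_zero (x) : (0 : V2 n).fn x = 0 := rfl

theorem V2.ext {u v : V2 n} (h : ∀ x, u.fn x = v.fn x) : u = v := Subtype.ext (funext h)

def V2.ev (x : Fin n → ℝ) : V2 n →ₗ[ℝ] ℝ where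
  toFun u := u.fn x
  map_add' _ _ := rfl
  map_smul' _ _ := rfl

@[simp] theorem V2.fn_sum {ι : Type*} (s : Finset ι) (u : ι → V2 n) (x) :
    (∑ i ∈ s, u i).fn x = ∑ i ∈ s, (u i).fn x := map_sum (V2.ev x) u s

theorem V2.integrable_mul (u v : V2 n) : Integrable (fun x => u.fn x * v.fn x) volume :=
  MemLp.integrable_mul u.mem v.mem

def V2.core (n : ℕ) : PreInnerProductSpace.Core ℝ (V2 n) where
  inner u v := ∫ x, u.fn x * v.fn x
  conj_inner_symm u v := by simp [mul_comm]
  re_inner_nonneg u := by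
    simp only [RCLike.re_to_real]
    exact integral_nonneg fun x => mul_self_nonneg _
  add_left u v w := by
    simp only [V2.fn_add, add_mul]
    exact integral_add (V2.integrable_mul u w) (V2.integrable_mul v w)
  smul_left u v r := by
    simp only [V2.fn_smul, mul_assoc, conj_trivial]
    exact integral_const_mul _ _

instance (n : ℕ) : SeminormedAddCommGroup (V2 n) :=
  @InnerProductSpace.Core.toSeminormedAddCommGroup ℝ (V2 n) _ _ _ (V2.core n)
instance (n : ℕ) : InnerProductSpace ℝ (V2 n) := InnerProductSpace.ofCore (V2.core n)

theorem V2.inner_def (u v : V2 n) : inner ℝ u v = ∫ x, u.fn x * v.fn x := rfl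

theorem V2.norm_sq (u : V2 n) : ‖u‖^2 = ∫ x, u.fn x ^ 2 := by
  rw [← real_inner_self_eq_norm_sq, V2.inner_def]; simp only [sq]

theorem V2.norm_eLp (u : V2 n) : ENNReal.ofReal ‖u‖ = eLpNorm u.fn 2 volume := by
  rw [u.mem.eLpNorm_eq_integral_rpow_norm (by norm_num) (by norm_num)]
  congr 1
  have : ‖u‖ = Real.sqrt (‖u‖^2) := (Real.sqrt_sq (norm_nonneg _)).symm
  rw [this, V2.norm_sq, Real.sqrt_eq_rpow]
  simp

def shift (v : Fin n → ℝ) : V2 n →ₗ[ℝ] V2 n where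
  toFun u := V2.mk (fun x => u.fn (x + v))
    (u.mem.comp_measurePreserving (measurePreserving_add_right volume v))
  map_add' _ _ := rfl
  map_smul' _ _ := rfl

@[simp] theorem shift_fn (v : Fin n → ℝ) (u : V2 n) (x) : (shift v u).fn x = u.fn (x + v) := rfl

theorem shift_inner (v : Fin n → ℝ) (u w : V2 n) :
    inner ℝ (shift v u) w = inner ℝ u (shift (-v) w) := by
  simp only [V2.inner_def, shift_fn]
  rw [← integral_add_right_eq_self (fun x => u.fn x * w.fn (x + -v)) v]
  simp

theorem shift_norm (v : Fin n → ℝ) (u : V2 n) : ‖shift v u‖ = ‖u‖ := by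
  rw [← sq_eq_sq₀ (norm_nonneg _) (norm_nonneg _), ← real_inner_self_eq_norm_sq, shift_inner,
    ← real_inner_self_eq_norm_sq]
  congr 1
  apply V2.ext; intro x; simp

theorem cut_mem (r : ℝ) (u : (Fin n → ℝ) → ℝ) (hu : Continuous u) :
    MemLp (Set.indicator (Metric.closedBall 0 r) u) 2 volume := by
  have hK : IsCompact (Metric.closedBall (0 : Fin n → ℝ) r) := isCompact_closedBall _ _
  rw [memLp_indicator_iff_restrict hK.measurableSet]
  haveI : IsFiniteMeasure (volume.restrict (Metric.closedBall (0 : Fin n → ℝ) r)) :=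
    ⟨by rw [Measure.restrict_apply_univ]; exact hK.measure_lt_top⟩
  obtain ⟨C, hC⟩ := hK.exists_bound_of_continuousOn hu.continuousOn
  exact MemLp.of_bound hu.aestronglyMeasurable C
    ((ae_restrict_iff' hK.measurableSet).2 (Filter.Eventually.of_forall hC))

def cut (r : ℝ) (u : (Fin n → ℝ) → ℝ) (hu : Continuous u) : V2 n := V2.mk _ (cut_mem r u hu)

theorem cut_fn_in {r : ℝ} {u : (Fin n → ℝ) → ℝ} (hu : Continuous u) {x} (hx : ‖x‖ ≤ r) :
    (cut r u hu).fn x = u x := by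
  simp [cut, Set.indicator, hx]

theorem cut_fn_out {r : ℝ} {u : (Fin n → ℝ) → ℝ} (hu : Continuous u) {x} (hx : r < ‖x‖) :
    (cut r u hu).fn x = 0 := by
  simp [cut, Set.indicator, not_le.2 hx]

theorem cut_norm_le (r : ℝ) (u : (Fin n → ℝ) → ℝ) (hu : Continuous u) :
    ENNReal.ofReal ‖cut r u hu‖ ≤ eLpNorm u 2 volume := by
  rw [V2.norm_eLp]
  exact eLpNorm_indicator_le _

theorem cut_norm_eq (r : ℝ) (u : (Fin n → ℝ) → ℝ) (hu : Continuous u) :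
    ‖cut r u hu‖ = Real.sqrt (∫ x in Metric.closedBall 0 r, u x ^ 2) := by
  rw [← Real.sqrt_sq (norm_nonneg (cut r u hu)), V2.norm_sq]
  congr 1
  rw [← integral_indicator Metric.isClosed_closedBall.measurableSet]
  congr 1; ext x
  by_cases h : x ∈ Metric.closedBall (0 : Fin n → ℝ) r <;> simp [cut, Set.indicator, h]

theorem cut_norm_cont (r : ℝ) (F : ℝ → (Fin n → ℝ) → ℝ) (hF : Continuous (fun p : ℝ × (Fin n → ℝ) => F p.1 p.2))
    (hu : ∀ s, Continuous (F s)) : Continuous (fun s => ‖cut r (F s) (hu s)‖) := by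
  simp only [cut_norm_eq]
  apply Continuous.sqrt
  apply continuous_parametric_integral_of_continuous (f := fun s x => F s x ^ 2)
  · exact hF.pow 2
  · exact isCompact_closedBall _ _

def supp (r : ℝ) (u : V2 n) : Prop := ∀ x, r < ‖x‖ → u.fn x = 0

theorem supp.mono {r s : ℝ} {u : V2 n} (h : supp r u) (hrs : r ≤ s) : supp s u :=
  fun x hx => h x (hrs.trans_lt hx)

theorem supp.shift {r h : ℝ} {u : V2 n} (hu : supp r u) {v : Fin n → ℝ} (hv : ‖v‖ ≤ h) :
    supp (r + h) (shift v u) := by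
  intro x hx
  rw [shift_fn]
  apply hu
  have := norm_sub_le (x + v) v
  rw [add_sub_cancel_right] at this
  linarith

theorem supp.opA {r h l : ℝ} (hh : 0 ≤ h) {u : V2 n} (hu : supp r u) {v : Fin n → (Fin n → ℝ)} (hv : ∀ i, ‖v i‖ ≤ h) :
    supp (r + h) (opA (fun i => _root_.shift (v i)) (fun i => _root_.shift (- v i)) l u) := by
  intro x hx
  rw [opA_apply]
  have h1 := hu.mono (show r ≤ r + h by linarith) x hx
  have h2 := fun i => hu.shift (hv i) x hx
  have h3 := fun i => hu.shift (v := - v i) (by rw [norm_neg]; exact hv i) x hx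
  simp only [V2.fn_smul, V2.fn_sum, V2.fn_sub, h1, h2, h3]
  simp

theorem supp.psi {r h l : ℝ} (hh : 0 ≤ h) {g : V2 n} (hg : supp r g) {v : Fin n → (Fin n → ℝ)} (hv : ∀ i, ‖v i‖ ≤ h)
    (k : ℕ) :
    supp (r + k * h) (psi (_root_.opA (fun i => _root_.shift (v i)) (fun i => _root_.shift (- v i)) l) g k) := by
  induction k using Nat.strong_induction_on with
  | _ k ih =>
    match k with
    | 0 => intro x _; simp [_root_.psi]
    | 1 => rw [_root_.psi]; exact hg.mono (by push_cast; linarith)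
    | k+2 =>
      have i1 := ih (k+1) (by omega)
      have i0 := ih k (by omega)
      have i2 := i1.opA (l := l) hh hv
      intro x hx
      rw [psi_rec]
      push_cast at *
      simp only [V2.fn_sub, V2.fn_smul]
      rw [i1 x (by linarith), i0 x (by linarith), i2 x (by linarith)]
      simp

theorem inner_bound {ρ c : ℝ} {u w : V2 n} (hu : ∀ x, ‖x‖ ≤ ρ → |u.fn x| ≤ c) (hc : 0 ≤ c)
    (hw : supp ρ w) :
    |inner ℝ u w| ≤ c * ‖cut ρ (fun _ : Fin n → ℝ => (1:ℝ)) continuous_const‖ * ‖w‖ := by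
  have hw2 : MemLp (fun x => |w.fn x|) 2 volume := w.mem.norm
  set w' : V2 n := V2.mk (fun x => |w.fn x|) hw2
  set o := cut ρ (fun _ : Fin n → ℝ => (1:ℝ)) continuous_const
  have e : ‖w'‖ = ‖w‖ := by
    rw [← sq_eq_sq₀ (norm_nonneg _) (norm_nonneg _), V2.norm_sq, V2.norm_sq]
    simp [w']
  calc |inner ℝ u w| ≤ ∫ x, |u.fn x * w.fn x| := by
        rw [V2.inner_def]; exact abs_integral_le_integral_abs
    _ ≤ ∫ x, (c • o).fn x * w'.fn x := by
        apply integral_mono (V2.integrable_mul u w).abs (V2.integrable_mul _ _)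
        intro x
        simp only [V2.fn_smul, abs_mul]
        by_cases hx : ‖x‖ ≤ ρ
        · rw [cut_fn_in _ hx]
          have := hu x hx
          simp only [w', V2.fn_mk]
          nlinarith [abs_nonneg (w.fn x)]
        · rw [hw x (not_le.1 hx)]
          simp [w', hw x (not_le.1 hx)]
    _ = inner ℝ (c • o) w' := rfl
    _ ≤ ‖c • o‖ * ‖w'‖ := real_inner_le_norm _ _
    _ = _ := by rw [norm_smul, e, Real.norm_of_nonneg hc]
end fspace

section calc1
open Filter Topology

theorem d1 (u u' : ℝ → ℝ) (hu : ∀ s, HasDerivAt u (u' s) s) (c ε s : ℝ)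
    (hb : ∀ x, |x| ≤ |s| → |u' x - c| ≤ ε) : |u s - u 0 - s * c| ≤ ε * |s| := by
  have := (convex_Icc (-|s|) |s|).norm_image_sub_le_of_norm_hasDerivWithin_le
    (f := fun x => u x - x * c) (f' := fun x => u' x - 1 * c) (C := ε) (x := 0) (y := s)
    (fun x _ => ((hu x).sub ((hasDerivAt_id x).mul_const c)).hasDerivWithinAt)
    (fun x hx => by rw [one_mul, Real.norm_eq_abs]; exact hb x (abs_le.2 hx))
    (by simp) (abs_le.1 le_rfl)
  simp only [Real.norm_eq_abs, sub_zero, zero_mul] at this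
  convert this using 2; ring

theorem d2 (u u' u'' : ℝ → ℝ) (hu : ∀ s, HasDerivAt u (u' s) s) (hu' : ∀ s, HasDerivAt u' (u'' s) s)
    (c ε s : ℝ) (hε : 0 ≤ ε)
    (hb : ∀ x, |x| ≤ |s| → |u'' x - c| ≤ ε) : |u s + u (-s) - 2 * u 0 - s^2 * c| ≤ 2 * ε * s^2 := by
  have := d1 (fun x => u x + u (-x) - x^2 * c) (fun x => u' x + u' (-x) * (-1) - (2 * x) * c)
    (fun x => by
      have h1 : HasDerivAt (fun x => u (-x)) (u' (-x) * (-1)) x :=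
        (hu (-x)).comp x (hasDerivAt_neg x)
      have h2 : HasDerivAt (fun x : ℝ => x^2 * c) ((2 * x) * c) x := by
        simpa using (hasDerivAt_pow 2 x).mul_const c
      exact ((hu x).add h1).sub h2) 0 (2 * ε * |s|) s (fun x hx => by
      have a1 := d1 u' u'' hu' c ε x (fun y hy => hb y (hy.trans hx))
      have a2 := d1 u' u'' hu' c ε (-x) (fun y hy => hb y (hy.trans (by rwa [abs_neg])))
      rw [abs_neg] at a2
      have : ε * |x| ≤ ε * |s| := by gcongr
      rw [abs_le] at *
      constructor <;> linarith [a1.1, a1.2, a2.1, a2.2])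
  have e : 2 * ε * s^2 = 2 * ε * |s| * |s| := by rw [mul_assoc, mul_assoc, abs_mul_abs_self]; ring
  rw [e]
  convert this using 2; simp; ring

variable {m : ℕ}

theorem pd_line (i : Fin m) (f : (Fin m → ℝ) → ℝ) (hf : Differentiable ℝ f) (y : Fin m → ℝ) (s : ℝ) :
    HasDerivAt (fun s : ℝ => f (y + s • Pi.single i 1)) (pd i f (y + s • Pi.single i 1)) s := by
  have h1 : HasDerivAt (fun s : ℝ => y + s • (Pi.single i 1 : Fin m → ℝ)) (Pi.single i 1) s := by
    simpa using ((hasDerivAt_id s).smul_const (Pi.single i 1 : Fin m → ℝ)).const_add y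
  exact (hf _).hasFDerivAt.comp_hasDerivAt s h1

theorem pd_smooth (i : Fin m) (f : (Fin m → ℝ) → ℝ) (hf : ContDiff ℝ (⊤:ℕ∞) f) :
    ContDiff ℝ (⊤:ℕ∞) (pd i f) := by
  unfold pd
  exact (hf.fderiv_right (by simp)).clm_apply contDiff_const

theorem single_norm (i : Fin m) (s : ℝ) : ‖s • (Pi.single i 1 : Fin m → ℝ)‖ = |s| := by
  rw [norm_smul, Pi.norm_single]; simp

theorem unif (i : Fin m) (F : (Fin m → ℝ) → ℝ) (hF : Continuous F) (ρ ε : ℝ) (hε : 0 < ε) :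
    ∀ᶠ s in 𝓝 (0:ℝ), ∀ y, ‖y‖ ≤ ρ → ∀ x : ℝ, |x| ≤ |s| →
      |F (y + x • Pi.single i 1) - F y| ≤ ε := by
  have hK : IsCompact (Metric.closedBall (0 : Fin m → ℝ) (ρ + 1)) := isCompact_closedBall _ _
  have hu := hK.uniformContinuousOn_of_continuous hF.continuousOn
  rw [Metric.uniformContinuousOn_iff] at hu
  obtain ⟨δ, hδ, h⟩ := hu ε hε
  have : ∀ᶠ s in 𝓝 (0:ℝ), |s| < min δ 1 := by
    have := Metric.ball_mem_nhds (0:ℝ) (show 0 < min δ 1 by positivity)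
    filter_upwards [this] with s hs
    simpa using hs
  filter_upwards [this] with s hs y hy x hx
  have hx1 := hx.trans_lt (hs.trans_le (min_le_right _ _))
  have hxd := hx.trans_lt (hs.trans_le (min_le_left _ _))
  have := h (y + x • Pi.single i 1) (by
    rw [mem_closedBall_zero_iff]
    refine (norm_add_le _ _).trans ?_
    rw [single_norm]; linarith) y (by rw [mem_closedBall_zero_iff]; linarith)
    (by rw [dist_eq_norm, add_sub_cancel_left, single_norm]; exact hxd)
  rw [Real.dist_eq] at this
  exact this.le

theorem con1 (i : Fin m) (f : (Fin m → ℝ) → ℝ) (hf : ContDiff ℝ (⊤:ℕ∞) f) (ρ ε : ℝ) (hε : 0 < ε) :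
    ∀ᶠ s in 𝓝 (0:ℝ), ∀ y, ‖y‖ ≤ ρ →
      |f (y + s • Pi.single i 1) - f y - s * pd i f y| ≤ ε * |s| := by
  filter_upwards [unif i (pd i f) (pd_smooth i f hf).continuous ρ ε hε] with s hs y hy
  have := d1 _ _ (pd_line i f (hf.differentiable (by simp)) y) (pd i f y) ε s (hs y hy)
  simpa using this

theorem con2 (i : Fin m) (f : (Fin m → ℝ) → ℝ) (hf : ContDiff ℝ (⊤:ℕ∞) f) (ρ ε : ℝ) (hε : 0 < ε) :
    ∀ᶠ s in 𝓝 (0:ℝ), ∀ y, ‖y‖ ≤ ρ →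
      |f (y + s • Pi.single i 1) + f (y + (-s) • Pi.single i 1) - 2 * f y - s^2 * pd i (pd i f) y|
        ≤ 2 * ε * s^2 := by
  have h1 := pd_smooth i f hf
  have h2 := pd_smooth i _ h1
  filter_upwards [unif i _ h2.continuous ρ ε hε] with s hs y hy
  have := d2 _ _ _ (pd_line i f (hf.differentiable (by simp)) y)
    (pd_line i _ (h1.differentiable (by simp)) y) (pd i (pd i f) y) ε s hε.le (hs y hy)
  simpa using this

theorem riem (F : ℝ → ℝ) (hF : Continuous F) (t : ℝ) (ht : 0 < t) (ε : ℝ) (hε : 0 < ε) :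
    ∀ᶠ N : ℕ in atTop, (t/(N+1)) * ∑ j ∈ Finset.range (N+1), F (((j+1 : ℕ):ℝ) * (t/(N+1)))
      ≤ (∫ s in (0:ℝ)..t, F s) + ε * t := by
  have hu := (isCompact_Icc (a := 0) (b := t)).uniformContinuousOn_of_continuous hF.continuousOn
  rw [Metric.uniformContinuousOn_iff] at hu
  obtain ⟨δ, hδ, h⟩ := hu ε hε
  have hl : Tendsto (fun N : ℕ => t/((N:ℝ)+1)) atTop (𝓝 0) :=
    tendsto_const_div_atTop_nhds_zero_nat t |>.comp (tendsto_add_atTop_nat 1) |>.congr (by intro; simp)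
  filter_upwards [hl.eventually (gt_mem_nhds hδ)] with N hN
  set τ := t/((N:ℝ)+1) with hτ
  have hτp : 0 < τ := by positivity
  have hNt : ((N:ℝ)+1) * τ = t := by rw [hτ]; field_simp
  have hI : ∀ a b, IntervalIntegrable F volume a b := fun a b => hF.intervalIntegrable a b
  have hsum := intervalIntegral.sum_integral_adjacent_intervals (f := F) (μ := volume) (a := fun k : ℕ => (k:ℝ) * τ)
    (n := N+1) (fun k _ => hI _ _)
  simp only [Nat.cast_zero, zero_mul, Nat.cast_add, Nat.cast_one, hNt] at hsum
  have hc : ε * t = ∑ j ∈ Finset.range (N+1), ε * τ := by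
    simp; rw [← hNt]; ring
  rw [← hsum, hc, ← Finset.sum_add_distrib, Finset.mul_sum]
  apply Finset.sum_le_sum
  intro j hj
  have hj : (j:ℝ) + 1 ≤ N + 1 := by
    have := Finset.mem_range.1 hj
    exact_mod_cast this
  have hle : (j:ℝ) * τ ≤ ((j:ℝ)+1) * τ := by nlinarith
  have hub : ((j:ℝ)+1) * τ ≤ t := by rw [← hNt]; gcongr
  have key : ∫ s in ((j:ℝ) * τ)..(((j:ℝ)+1) * τ), (F (((j:ℝ)+1) * τ) - ε) ≤ ∫ s in ((j:ℝ) * τ)..(((j:ℝ)+1) * τ), F s := by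
    apply intervalIntegral.integral_mono_on hle (by simp) (hI _ _)
    intro s hs
    have h0 : 0 ≤ (j:ℝ) * τ := by positivity
    have := h (((j:ℝ)+1) * τ) ⟨by linarith, hub⟩ s ⟨h0.trans hs.1, hs.2.trans hub⟩
      (by rw [Real.dist_eq, abs_of_nonneg (by linarith [hs.2])]; nlinarith [hs.1])
    rw [Real.dist_eq, abs_lt] at this
    linarith [this.2]
  rw [intervalIntegral.integral_const, smul_eq_mul] at key
  push_cast
  nlinarith
end calc1

section mainsec
open Filter Topology

theorem pt_res {n : ℕ} (τ h ε D0 P0 G0 q0 a0 : ℝ) (D P G q a : Fin n → ℝ) (hτ : 0 < τ) (hh : 0 < h)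
    (h1 : |D0 - τ^2 * P0| ≤ 2 * ε * τ^2) (h2 : ∀ i, |D i - h^2 * P i| ≤ 2 * ε * h^2)
    (h3 : |G0 - τ * q0| ≤ ε * τ) (h4 : ∀ i, |G i - h * q i| ≤ ε * h)
    (hP : P0 - ∑ i, P i = a0 * q0 + ∑ i, a i * q i) :
    |D0 - (τ/h)^2 * ∑ i, D i - τ^2 * (a0 * (1/τ * G0) + ∑ i, a i * (1/h * G i))|
      ≤ ε * τ^2 * (2 + 2 * n + |a0| + ∑ i, |a i|) := by
  have e : D0 - (τ/h)^2 * ∑ i, D i - τ^2 * (a0 * (1/τ * G0) + ∑ i, a i * (1/h * G i))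
      = (D0 - τ^2 * P0) + (- ∑ i, (τ/h)^2 * (D i - h^2 * P i)) + (- (τ * a0 * (G0 - τ * q0)))
        + (- ∑ i, τ^2 / h * a i * (G i - h * q i)) := by
    have e1 : ∑ i, (τ/h)^2 * (D i - h^2 * P i) = (τ/h)^2 * ∑ i, D i - τ^2 * ∑ i, P i := by
      rw [Finset.mul_sum, Finset.mul_sum, ← Finset.sum_sub_distrib]
      apply Finset.sum_congr rfl; intro i _; field_simp
    have e2 : ∑ i, τ^2 / h * a i * (G i - h * q i)
        = τ^2 * ∑ i, a i * (1/h * G i) - τ^2 * ∑ i, a i * q i := by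
      rw [Finset.mul_sum, Finset.mul_sum, ← Finset.sum_sub_distrib]
      apply Finset.sum_congr rfl; intro i _; field_simp
    rw [e1, e2]
    have e3 : τ^2 * (a0 * (1/τ * G0)) = τ * a0 * G0 := by field_simp
    rw [mul_add, e3]
    have : P0 = ∑ i, P i + (a0 * q0 + ∑ i, a i * q i) := by linarith
    rw [this]; ring
  rw [e]
  have b2 : |- ∑ i, (τ/h)^2 * (D i - h^2 * P i)| ≤ 2 * n * ε * τ^2 := by
    rw [abs_neg]
    refine (Finset.abs_sum_le_sum_abs _ _).trans ?_
    have : ∀ i ∈ Finset.univ, |(τ/h)^2 * (D i - h^2 * P i)| ≤ 2 * ε * τ^2 := by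
      intro i _
      rw [abs_mul, abs_of_pos (by positivity)]
      calc (τ/h)^2 * |D i - h^2 * P i| ≤ (τ/h)^2 * (2 * ε * h^2) := by gcongr; exact h2 i
        _ = _ := by field_simp
    refine (Finset.sum_le_sum this).trans (le_of_eq ?_)
    simp; ring
  have b3 : |- (τ * a0 * (G0 - τ * q0))| ≤ ε * τ^2 * |a0| := by
    rw [abs_neg, abs_mul, abs_mul, abs_of_pos hτ]
    calc τ * |a0| * |G0 - τ * q0| ≤ τ * |a0| * (ε * τ) := by gcongr
      _ = _ := by ring
  have b4 : |- ∑ i, τ^2 / h * a i * (G i - h * q i)| ≤ ε * τ^2 * ∑ i, |a i| := by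
    rw [abs_neg, Finset.mul_sum]
    refine (Finset.abs_sum_le_sum_abs _ _).trans (Finset.sum_le_sum ?_)
    intro i _
    rw [abs_mul, abs_mul, abs_of_pos (show 0 < τ^2/h by positivity)]
    calc τ^2 / h * |a i| * |G i - h * q i| ≤ τ^2 / h * |a i| * (ε * h) := by gcongr; exact h4 i
      _ = _ := by field_simp
  refine (abs_add_le _ _).trans ((add_le_add ((abs_add_le _ _).trans (add_le_add ((abs_add_le _ _).trans (add_le_add h1 b2)) b3)) b4).trans (le_of_eq ?_))
  ring

variable {n : ℕ}

theorem cons_cont : Continuous (fun p : ℝ × (Fin n → ℝ) => (Fin.cons p.1 p.2 : Fin (n+1) → ℝ)) := by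
  apply continuous_pi
  intro i
  refine Fin.cases ?_ (fun j => ?_) i
  · simpa using continuous_fst
  · simp only [Fin.cons_succ]; fun_prop

theorem sl_cont {F : (Fin (n+1) → ℝ) → ℝ} (hF : Continuous F) (s : ℝ) :
    Continuous (fun x : Fin n → ℝ => F (Fin.cons s x)) :=
  hF.comp (cons_cont.comp (by fun_prop : Continuous fun x : Fin n → ℝ => (s, x)))

def cs (R : ℝ) (F : (Fin (n+1) → ℝ) → ℝ) (hF : Continuous F) (s : ℝ) : V2 n :=
  cut R (fun x => F (Fin.cons s x)) (sl_cont hF s)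

theorem cs_cont (R : ℝ) (F : (Fin (n+1) → ℝ) → ℝ) (hF : Continuous F) :
    Continuous (fun s => ‖cs R F hF s‖) :=
  cut_norm_cont R (fun s x => F (Fin.cons s x)) (hF.comp cons_cont) (sl_cont hF)

theorem cs_in {R : ℝ} {F : (Fin (n+1) → ℝ) → ℝ} (hF : Continuous F) (s : ℝ) {x : Fin n → ℝ}
    (hx : ‖x‖ ≤ R) : (cs R F hF s).fn x = F (Fin.cons s x) := cut_fn_in _ hx

theorem cs_le (R : ℝ) (F : (Fin (n+1) → ℝ) → ℝ) (hF : Continuous F) (s : ℝ) :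
    ENNReal.ofReal ‖cs R F hF s‖ ≤ sliceNorm F s 2 := cut_norm_le _ _ _

theorem cons_time (s d : ℝ) (x : Fin n → ℝ) :
    (Fin.cons (s + d) x : Fin (n+1) → ℝ) = (Fin.cons s x : Fin (n+1) → ℝ) + d • Pi.single 0 1 := by
  ext i
  refine Fin.cases ?_ (fun j => ?_) i
  · simp
  · simp

theorem cons_space (s d : ℝ) (x : Fin n → ℝ) (i : Fin n) :
    (Fin.cons s (x + d • Pi.single i 1) : Fin (n+1) → ℝ)
      = (Fin.cons s x : Fin (n+1) → ℝ) + d • Pi.single i.succ 1 := by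
  ext j
  refine Fin.cases ?_ (fun j => ?_) j
  · simp
  · by_cases h : j = i
    · subst h; simp
    · simp [Pi.single_apply, h]

theorem cons_norm (s P : ℝ) (x : Fin n → ℝ) (hs : |s| ≤ P) (hx : ‖x‖ ≤ P) :
    ‖(Fin.cons s x : Fin (n+1) → ℝ)‖ ≤ P := by
  have hP : 0 ≤ P := (abs_nonneg _).trans hs
  rw [pi_norm_le_iff_of_nonneg hP]
  intro i
  refine Fin.cases ?_ (fun j => ?_) i
  · simpa using hs
  · simpa using (norm_le_pi_norm x j).trans hx

theorem main_eps (hn : 1 ≤ n) (T : ℝ)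
    (a : Fin (n+1) → ℝ) (φ : (Fin (n+1) → ℝ) → ℝ)
    (f : Fin (n+1) → (Fin (n+1) → ℝ) → ℝ)
    (hφ : ContDiff ℝ (⊤:ℕ∞) φ) (hf : ∀ j, ContDiff ℝ (⊤:ℕ∞) (f j))
    (hPDE : ∀ y : Fin (n+1) → ℝ, y 0 ∈ Set.Icc 0 T →
      waveOp φ y = ∑ j, a j * pd j (f j) y)
    (hi0 : ∀ x : Fin n → ℝ, φ (Fin.cons 0 x) = 0 ∧ pd 0 φ (Fin.cons 0 x) = 0)
    (t : ℝ) (ht : 0 < t) (htT : t ≤ T) (r : ℝ) (hr : 0 ≤ r) (R ρ L κ : ℝ) (hR : R = r + 4 * n * t)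
    (hρ : ρ = r + 2 * n * t) (hL : L = 2 + 2 * n + |a 0| + ∑ i : Fin n, |a i.succ|)
    (hκ : κ = ‖cut ρ (fun _ : Fin n → ℝ => (1:ℝ)) continuous_const‖)
    (ε : ℝ) (hε : 0 < ε) :
    ‖cs r φ hφ.continuous t‖ ≤ 2 * (ε * L * κ) * t + 2 * (ε * L * κ) * t^2
      + 2 * (|a 0| * (t * (‖cs R (f 0) (hf 0).continuous 0‖ + ε)
            + ((∫ s in (0:ℝ)..t, ‖cs R (f 0) (hf 0).continuous s‖) + ε * t))
        + ∑ i : Fin n, |a i.succ| * ((∫ s in (0:ℝ)..t, ‖cs R (f i.succ) (hf i.succ).continuous s‖) + ε * t)) := by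
  have hnR : (1:ℝ) ≤ n := by exact_mod_cast hn
  have hnt : 0 < (n:ℝ) * t := by positivity
  have hl : Tendsto (fun N : ℕ => t/((N:ℝ)+1)) atTop (𝓝 0) :=
    tendsto_const_div_atTop_nhds_zero_nat t |>.comp (tendsto_add_atTop_nat 1) |>.congr (by intro; simp)
  have hl2 : Tendsto (fun N : ℕ => 2 * n * (t/((N:ℝ)+1))) atTop (𝓝 0) := by
    simpa using hl.const_mul (2 * (n:ℝ))
  set P := ρ + T with hP
  have E1 := hl.eventually (con2 0 φ hφ P ε hε)
  have E2 := eventually_all.2 fun i : Fin n => hl2.eventually (con2 i.succ φ hφ P ε hε)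
  have E3 := hl.eventually (con1 0 (f 0) (hf 0) P ε hε)
  have E4 := eventually_all.2 fun i : Fin n => hl2.eventually (con1 i.succ (f i.succ) (hf i.succ) P ε hε)
  have E5 := hl.eventually (con1 0 φ hφ P ε hε)
  have E6 := riem _ (cs_cont R (f 0) (hf 0).continuous) t ht ε hε
  have E7 := eventually_all.2 fun i : Fin n => riem _ (cs_cont R (f i.succ) (hf i.succ).continuous) t ht ε hε
  have E8 : ∀ᶠ N : ℕ in atTop, ‖cs R (f 0) (hf 0).continuous (t/((N:ℝ)+1))‖
      < ‖cs R (f 0) (hf 0).continuous 0‖ + ε :=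
    hl.eventually (((cs_cont R (f 0) (hf 0).continuous).tendsto 0).eventually
      (gt_mem_nhds (by linarith)))
  obtain ⟨M, e1, e2, e3, e4, e5, e6, e7, e8⟩ :=
    (E1.and (E2.and (E3.and (E4.and (E5.and (E6.and (E7.and E8))))))).exists
  clear E1 E2 E3 E4 E5 E6 E7 E8
  set τ := t/((M:ℝ)+1) with hτdef
  have hτ : 0 < τ := by positivity
  have hMt : ((M:ℝ)+1) * τ = t := by rw [hτdef]; field_simp
  have hτt : τ ≤ t := by rw [hτdef]; exact div_le_self ht.le (by linarith [Nat.cast_nonneg (α := ℝ) M])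
  set h := 2 * n * τ with hh
  have hhp : 0 < h := by positivity
  rw [abs_of_pos hτ] at e3 e5
  rw [abs_of_pos hhp] at e4
  set v : Fin n → (Fin n → ℝ) := fun i => h • Pi.single i 1 with hv
  have hvn : ∀ i, ‖v i‖ ≤ h := fun i => by simp only [hv]; rw [single_norm, abs_of_pos hhp]
  set g := cs r φ hφ.continuous t with hg
  have hgs : supp r (τ • g) := fun x hx => by
    rw [V2.fn_smul, hg, cs, cut_fn_out _ hx, mul_zero]
  have hhR : ρ + h ≤ R := by
    rw [hρ, hR, hh]
    nlinarith
  have hpsi : ∀ k ≤ M+1, supp ρ (psi (opA (fun i => shift (v i)) (fun i => shift (- v i)) (τ/h)) (τ • g) k) := by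
    intro k hk
    refine (hgs.psi hhp.le hvn k).mono ?_
    have : (k:ℝ) ≤ M+1 := by exact_mod_cast hk
    have : k * h ≤ (M+1) * h := by gcongr
    have : (M+1) * h = 2 * n * t := by rw [hh, ← hMt]; ring
    rw [hρ]; linarith
  have hκ0 : 0 ≤ κ := by rw [hκ]; exact norm_nonneg _
  have hL1 : 1 ≤ L := by
    rw [hL]
    have : 0 ≤ ∑ i : Fin n, |a i.succ| := Finset.sum_nonneg fun _ _ => abs_nonneg _
    have := abs_nonneg (a 0)
    linarith
  have hT : 0 ≤ T := ht.le.trans htT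
  have hρ0 : 0 ≤ ρ := by rw [hρ]; nlinarith
  have key := abs_res (fun i => shift (v i)) (fun i => shift (- v i)) τ h (ε * L * κ) hn hτ hh
    (by positivity) (fun i u w => shift_inner _ _ _) (fun i u => shift_norm _ _) (fun i u => shift_norm _ _)
    (a 0) (fun i => a i.succ) (fun k => cs R φ hφ.continuous ((k:ℝ) * τ))
    (fun k => cs R (f 0) (hf 0).continuous ((k:ℝ) * τ))
    (fun i k => cs R (f i.succ) (hf i.succ).continuous ((k:ℝ) * τ)) g M ?_ ?_ ?_
  · have hself : inner ℝ (cs R φ hφ.continuous (((M+1 : ℕ):ℝ) * τ)) g = ‖g‖^2 := by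
      push_cast
      rw [hMt, ← real_inner_self_eq_norm_sq, V2.inner_def, V2.inner_def]
      congr 1; ext x
      by_cases hx : ‖x‖ ≤ r
      · rw [hg, cs_in _ _ hx, cs_in _ _ (by linarith : ‖x‖ ≤ R)]
      · rw [hg, cs, cs, cut_fn_out (r := r) _ (not_le.1 hx)]; simp
    simp only [hself, hMt] at key
    rw [abs_of_nonneg (sq_nonneg _), sq] at key
    have h8 : ‖cs R (f 0) (hf 0).continuous (((1:ℕ):ℝ) * τ)‖ ≤ ‖cs R (f 0) (hf 0).continuous 0‖ + ε := by
      rw [Nat.cast_one, one_mul]; exact e8.le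
    rcases (norm_nonneg g).eq_or_lt with h0 | h0
    · rw [← h0]
      have I0 : 0 ≤ ∫ s in (0:ℝ)..t, ‖cs R (f 0) (hf 0).continuous s‖ :=
        intervalIntegral.integral_nonneg ht.le fun _ _ => norm_nonneg _
      have I1 : ∀ i : Fin n, 0 ≤ ∫ s in (0:ℝ)..t, ‖cs R (f i.succ) (hf i.succ).continuous s‖ :=
        fun i => intervalIntegral.integral_nonneg ht.le fun _ _ => norm_nonneg _
      have I2 : 0 ≤ ∑ i : Fin n, |a i.succ| * ((∫ s in (0:ℝ)..t, ‖cs R (f i.succ) (hf i.succ).continuous s‖) + ε * t) :=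
        Finset.sum_nonneg fun i _ => by have := I1 i; positivity
      positivity
    · refine (le_of_mul_le_mul_left key h0).trans ?_
      gcongr with i _
      · exact e7 i
  · apply V2.ext; intro x
    rw [Nat.cast_zero, zero_mul]
    by_cases hx : ‖x‖ ≤ R
    · rw [cs_in _ _ hx, (hi0 x).1]; rfl
    · rw [cs, cut_fn_out _ (not_le.1 hx)]; rfl
  · have := inner_bound (u := cs R φ hφ.continuous (((1:ℕ):ℝ) * τ)) (c := ε * τ * L) (fun x hx => ?_) (by positivity) (hpsi (M+1) le_rfl)
    · rw [← hκ] at this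
      refine this.trans (le_of_eq ?_); ring
    · rw [cs_in _ _ (by linarith), Nat.cast_one, one_mul]
      have := e5 (Fin.cons 0 x) (cons_norm _ _ _ (by simp; linarith) (by linarith))
      rw [← cons_time, (hi0 x).1, (hi0 x).2, zero_add] at this
      simp only [mul_zero, sub_zero] at this
      refine this.trans ?_
      have : 0 < ε * τ := by positivity
      nlinarith
  · intro j k hjk hk
    have := inner_bound (c := ε * τ^2 * L) (u := cs R φ hφ.continuous (((j+2:ℕ):ℝ) * τ) - (2:ℝ) • cs R φ hφ.continuous (((j+1:ℕ):ℝ) * τ)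
        + cs R φ hφ.continuous ((j:ℝ) * τ) + opA (fun i => shift (v i)) (fun i => shift (- v i)) (τ/h) (cs R φ hφ.continuous (((j+1:ℕ):ℝ) * τ))
        - τ^2 • (a 0 • (1/τ) • (cs R (f 0) (hf 0).continuous (((j+2:ℕ):ℝ) * τ) - cs R (f 0) (hf 0).continuous (((j+1:ℕ):ℝ) * τ)) +
          ∑ i : Fin n, a i.succ • (1/h) • (shift (v i) (cs R (f i.succ) (hf i.succ).continuous (((j+1:ℕ):ℝ) * τ)) - cs R (f i.succ) (hf i.succ).continuous (((j+1:ℕ):ℝ) * τ))))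
      (fun x hx => ?_) (by positivity) (hpsi k (by omega))
    · rw [← hκ] at this
      refine this.trans (le_of_eq ?_); ring
    · have hxR : ‖x‖ ≤ R := by linarith
      have hxp : ∀ i, ‖x + v i‖ ≤ R := fun i => (norm_add_le _ _).trans (by linarith [hvn i])
      have hxm : ∀ i, ‖x + - v i‖ ≤ R := fun i => (norm_add_le _ _).trans (by rw [norm_neg]; linarith [hvn i])
      set s := ((j+1:ℕ):ℝ) * τ with hs
      have hs2 : ((j+2:ℕ):ℝ) * τ = s + τ := by rw [hs]; push_cast; ring
      have hs0 : (j:ℝ) * τ = s + -τ := by rw [hs]; push_cast; ring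
      have hspos : 0 ≤ s := by positivity
      have hst : s ≤ t := by
        rw [hs, ← hMt]
        have : ((j+1:ℕ):ℝ) ≤ M + 1 := by
          have : j + 1 ≤ M + 1 := by omega
          exact_mod_cast this
        gcongr
      have hvm : ∀ i, x + - v i = x + (-h) • Pi.single i 1 := fun i => by simp [hv]
      set y : Fin (n+1) → ℝ := Fin.cons s x with hy
      have hyn : ‖y‖ ≤ P := cons_norm _ _ _ (by rw [abs_of_nonneg hspos]; linarith) (by linarith)
      have hpde := hPDE y (by simp [hy]; exact ⟨hspos, hst.trans htT⟩)
      rw [waveOp, Fin.sum_univ_succ] at hpde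
      have fin := pt_res τ h ε _ (pd 0 (pd 0 φ) y) _ (pd 0 (f 0) y) (a 0) _ (fun i => pd i.succ (pd i.succ φ) y)
        _ (fun i => pd i.succ (f i.succ) y) (fun i => a i.succ) hτ hhp (e1 y hyn) (fun i => e2 i y hyn)
        (e3 y hyn) (fun i => e4 i y hyn) hpde
      rw [hL]
      refine le_trans (le_of_eq ?_) fin
      congr 1
      rw [opA_apply]
      simp only [V2.fn_add, V2.fn_sub, V2.fn_smul, V2.fn_sum, shift_fn]
      simp only [cs_in _ _ hxR, cs_in _ _ (hxp _), cs_in _ _ (hxm _), hs2, hs0]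
      simp only [hvm]
      simp only [hv, cons_time, cons_space, ← hy]
      have : ∑ i : Fin n, (2 * φ y - φ (y + h • Pi.single i.succ 1) - φ (y + (-h) • Pi.single i.succ 1))
        = - ∑ i : Fin n, (φ (y + h • Pi.single i.succ 1) + φ (y + (-h) • Pi.single i.succ 1) - 2 * φ y) := by
        rw [← Finset.sum_neg_distrib]
        apply Finset.sum_congr rfl; intros; ring
      rw [this]
      ring
end mainsec

section fin
open Filter Topology

theorem slice_le {n : ℕ} (F : (Fin (n+1) → ℝ) → ℝ) (hF : Continuous F) (t : ℝ) (B : ℝ≥0∞)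
    (h : ∀ k : ℕ, ENNReal.ofReal ‖cs (k:ℝ) F hF t‖ ≤ B) : sliceNorm F t 2 ≤ B := by
  have := Lp.eLpNorm_lim_le_liminf_eLpNorm (p := 2) (μ := (volume : Measure (Fin n → ℝ)))
    (f := fun k : ℕ => (cs (k:ℝ) F hF t).fn) (fun k => (cs (k:ℝ) F hF t).mem.1)
    (fun x => F (Fin.cons t x)) (Eventually.of_forall fun x => by
      apply tendsto_const_nhds.congr'
      filter_upwards [eventually_ge_atTop ⌈‖x‖⌉₊] with k hk
      rw [cs_in hF t ((Nat.le_ceil _).trans (by exact_mod_cast hk))])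
  refine this.trans ?_
  refine liminf_le_of_le (by isBoundedDefault) ?_
  intro b hb
  obtain ⟨k, hk⟩ := hb.exists
  refine hk.trans ?_
  rw [← V2.norm_eLp]; exact h k

theorem main_real {n : ℕ} (hn : 1 ≤ n) (T : ℝ)
    (a : Fin (n+1) → ℝ) (φ : (Fin (n+1) → ℝ) → ℝ)
    (f : Fin (n+1) → (Fin (n+1) → ℝ) → ℝ)
    (hφ : ContDiff ℝ (⊤:ℕ∞) φ) (hf : ∀ j, ContDiff ℝ (⊤:ℕ∞) (f j))
    (hPDE : ∀ y : Fin (n+1) → ℝ, y 0 ∈ Set.Icc 0 T →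
      waveOp φ y = ∑ j, a j * pd j (f j) y)
    (hi0 : ∀ x : Fin n → ℝ, φ (Fin.cons 0 x) = 0 ∧ pd 0 φ (Fin.cons 0 x) = 0)
    (t : ℝ) (ht : 0 < t) (htT : t ≤ T) (r : ℝ) (hr : 0 ≤ r) :
    ∃ R, ‖cs r φ hφ.continuous t‖ ≤ (2 * (∑ j, |a j|) * (1 + T) + 1) *
      ((∑ j, ∫ s in (0:ℝ)..t, ‖cs R (f j) (hf j).continuous s‖) + ‖cs R (f 0) (hf 0).continuous 0‖) := by
  refine ⟨r + 4 * n * t, ?_⟩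
  set R := r + 4 * n * t with hR
  have key := main_eps hn T a φ f hφ hf hPDE hi0 t ht htT r hr R _ _ _ hR rfl rfl rfl
  set ρ := r + 2 * n * t
  set L := 2 + 2 * n + |a 0| + ∑ i : Fin n, |a i.succ|
  set κ := ‖cut ρ (fun _ : Fin n → ℝ => (1:ℝ)) continuous_const‖
  set N0 := ‖cs R (f 0) (hf 0).continuous 0‖
  set I : Fin (n+1) → ℝ := fun j => ∫ s in (0:ℝ)..t, ‖cs R (f j) (hf j).continuous s‖ with hI
  have lim : Tendsto (fun ε : ℝ => 2 * (ε * L * κ) * t + 2 * (ε * L * κ) * t^2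
      + 2 * (|a 0| * (t * (N0 + ε) + (I 0 + ε * t))
        + ∑ i : Fin n, |a i.succ| * (I i.succ + ε * t))) (𝓝[>] 0)
      (𝓝 (2 * ((0:ℝ) * L * κ) * t + 2 * (0 * L * κ) * t^2
      + 2 * (|a 0| * (t * (N0 + 0) + (I 0 + 0 * t))
        + ∑ i : Fin n, |a i.succ| * (I i.succ + 0 * t)))) := by
    refine (Continuous.tendsto ?_ 0).mono_left nhdsWithin_le_nhds
    fun_prop
  have h0 := ge_of_tendsto lim (eventually_mem_nhdsWithin.mono fun ε hε => key ε hε)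
  refine h0.trans ?_
  have hI0 : ∀ j, 0 ≤ I j := fun j => intervalIntegral.integral_nonneg ht.le fun _ _ => norm_nonneg _
  have hN0 : 0 ≤ N0 := norm_nonneg _
  have hS : 0 ≤ ∑ j, |a j| := Finset.sum_nonneg fun _ _ => abs_nonneg _
  have hle : ∀ j, |a j| ≤ ∑ j, |a j| := fun j =>
    Finset.single_le_sum (f := fun j => |a j|) (fun _ _ => abs_nonneg _) (Finset.mem_univ j)
  simp only [zero_mul, mul_zero, add_zero, zero_add]
  set Sa := ∑ j, |a j|
  have hsum : |a 0| * I 0 + ∑ i : Fin n, |a i.succ| * I i.succ ≤ Sa * ∑ j, I j := by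
    have := Fin.sum_univ_succ (fun j => |a j| * I j)
    rw [← this, Finset.mul_sum]
    exact Finset.sum_le_sum fun j _ => mul_le_mul_of_nonneg_right (hle j) (hI0 j)
  have hSI : 0 ≤ ∑ j, I j := Finset.sum_nonneg fun j _ => hI0 j
  have hT : 0 ≤ T := ht.le.trans htT
  have h1 : |a 0| * (t * N0) ≤ Sa * (T * N0) := by
    gcongr
    exact hle 0
  have x1 : 0 ≤ Sa * T * ∑ j, I j := by positivity
  have x2 : 0 ≤ Sa * N0 := by positivity
  nlinarith
end fin

/-- `L²` estimate for the wave equation with a source in divergence form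
`φ_tt − Δφ = Σ_j a_j ∂_j f_j` and zero initial data. -/
theorem stmt_3 (n : ℕ) (hn : 1 ≤ n) (T : ℝ) (hT : 0 ≤ T)
    (a : Fin (n+1) → ℝ) (φ : (Fin (n+1) → ℝ) → ℝ)
    (f : Fin (n+1) → (Fin (n+1) → ℝ) → ℝ)
    (hφ : ContDiff ℝ (⊤:ℕ∞) φ) (hf : ∀ j, ContDiff ℝ (⊤:ℕ∞) (f j))
    (hPDE : ∀ y : Fin (n+1) → ℝ, y 0 ∈ Set.Icc 0 T →
      waveOp φ y = ∑ j, a j * pd j (f j) y)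
    (hi0 : ∀ x : Fin n → ℝ, φ (Fin.cons 0 x) = 0 ∧ pd 0 φ (Fin.cons 0 x) = 0) :
    ∃ C : ℝ≥0, 0 < C ∧ ∀ t ∈ Set.Icc 0 T,
      sliceNorm φ t 2 ≤
        C * ((∑ j, ∫⁻ τ in Set.Icc 0 t, sliceNorm (f j) τ 2) + sliceNorm (f 0) 0 2) := by
  have hS : 0 ≤ ∑ j, |a j| := Finset.sum_nonneg fun _ _ => abs_nonneg _
  have hCpos : 0 < 2 * (∑ j, |a j|) * (1 + T) + 1 := by positivity
  obtain ⟨C, hC⟩ : ∃ C : ℝ≥0, (C:ℝ) = 2 * (∑ j, |a j|) * (1 + T) + 1 := ⟨⟨_, hCpos.le⟩, rfl⟩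
  refine ⟨C, by rw [← NNReal.coe_pos, hC]; exact hCpos, ?_⟩
  intro t ht
  rcases ht.1.eq_or_lt with h0 | h0
  · subst h0
    have : sliceNorm φ 0 2 = 0 := by
      unfold sliceNorm
      have : (fun x : Fin n → ℝ => φ (Fin.cons 0 x)) = 0 := by
        funext x; exact (hi0 x).1
      rw [this]; exact eLpNorm_zero
    rw [this]; exact zero_le
  · apply slice_le φ hφ.continuous
    intro k
    obtain ⟨R, hR⟩ := main_real hn T a φ f hφ hf hPDE hi0 t h0 ht.2 k (Nat.cast_nonneg k)
    refine (ENNReal.ofReal_le_ofReal hR).trans ?_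
    have hI0 : ∀ j, 0 ≤ ∫ s in (0:ℝ)..t, ‖cs R (f j) (hf j).continuous s‖ :=
      fun j => intervalIntegral.integral_nonneg h0.le fun _ _ => norm_nonneg _
    rw [ENNReal.ofReal_mul hCpos.le, ENNReal.ofReal_add (Finset.sum_nonneg fun j _ => hI0 j) (norm_nonneg _),
      ENNReal.ofReal_sum_of_nonneg fun j _ => hI0 j]
    have hCe : ENNReal.ofReal (2 * (∑ j, |a j|) * (1 + T) + 1)
        = (C : ℝ≥0∞) := by
      rw [← hC]; exact ENNReal.ofReal_coe_nnreal
    rw [hCe]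
    gcongr with j _
    · rw [intervalIntegral.integral_of_le h0.le, ofReal_integral_eq_lintegral_ofReal]
      · refine (lintegral_mono_set Set.Ioc_subset_Icc_self).trans ?_
        exact lintegral_mono fun s => cs_le R (f j) _ s
      · exact ((cs_cont R (f j) (hf j).continuous).integrableOn_Icc).mono_set Set.Ioc_subset_Icc_self
      · exact Filter.Eventually.of_forall fun _ => norm_nonneg _
    · exact cs_le R (f 0) _ 0
end
end

section
/- Let I be a multi-index and let φ = φ(t,x) be a smooth function on [0,T] × ℝⁿ satisfying Σ_{|J| ≤ [|I|/2]} ‖Z^J φ(t,·)‖_{L^∞} ≤ ν₀ for all t ∈ [0,T]. Then for each i ∈ {0,1,…,n} there is a constant C(ν₀) such that ‖Z^I((e^{−φ} − 1)∂_i φ)(t,·)‖_{L²} ≤ C(ν₀) Σ_{|I₁| ≤ |I|} Σ_{|I₂| ≤ [(|I|−1)/2]} ‖Z^{I₁}φ(t,·)‖_{L²} ‖Z^{I₂}∂_i φ(t,·)‖_{L^∞} + C(ν₀) Σ_{|I₂| ≤ |I|} Σ_{|I₁| ≤ [|I|/2]} ‖Z^{I₁}φ(t,·)‖_{L^∞}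 ‖Z^{I₂}∂_i φ(t,·)‖_{L²}, provided all norms on the right-hand side are finite. -/
open MeasureTheory Real NNReal ENNReal

noncomputable section

def vV {n : ℕ} : VFIdx n → (Fin (n+1) → ℝ) → (Fin (n+1) → ℝ)
  | Sum.inl i => fun _ => Pi.single i 1
  | Sum.inr (Sum.inl _) => fun y => y
  | Sum.inr (Sum.inr (Sum.inl p)) => fun y =>
      y p.1.1.succ • Pi.single p.1.2.succ 1 - y p.1.2.succ • Pi.single p.1.1.succ 1
  | Sum.inr (Sum.inr (Sum.inr i)) => fun y => y 0 • Pi.single i.succ 1 + y i.succ • Pi.single 0 1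

theorem vf_eq {n : ℕ} (a : VFIdx n) (f : (Fin (n+1) → ℝ) → ℝ) (y : Fin (n+1) → ℝ) :
    vf a f y = fderiv ℝ f y (vV a y) := by
  rcases a with i | _ | p | i
  · rfl
  · simp only [vf, vV, pd]
    generalize fderiv ℝ f y = D
    conv_rhs => rw [pi_eq_sum_univ' y]
    rw [map_sum]
    refine Finset.sum_congr rfl fun i _ => ?_
    rw [map_smul, smul_eq_mul]
  · simp [vf, vV, pd]
  · simp [vf, vV, pd]

theorem vV_smooth {n : ℕ} (a : VFIdx n) : ContDiff ℝ (⊤:ℕ∞) (vV a) := by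
  rcases a with i | _ | p | i <;> simp only [vV] <;> fun_prop

theorem vf_smooth {n : ℕ} (a : VFIdx n) {f : (Fin (n+1) → ℝ) → ℝ} (hf : ContDiff ℝ (⊤:ℕ∞) f) :
    ContDiff ℝ (⊤:ℕ∞) (vf a f) := by
  have : vf a f = fun y => fderiv ℝ f y (vV a y) := funext (vf_eq a f)
  rw [this]
  exact (hf.fderiv_right (m := (⊤:ℕ∞)) (by simp)).clm_apply (vV_smooth a)

/-- Z along a list. -/
def ZL {n : ℕ} (w : List (VFIdx n)) (f : (Fin (n+1) → ℝ) → ℝ) : (Fin (n+1) → ℝ) → ℝ :=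
  w.foldr vf f

theorem ZL_smooth {n : ℕ} (w : List (VFIdx n)) {f : (Fin (n+1) → ℝ) → ℝ}
    (hf : ContDiff ℝ (⊤:ℕ∞) f) : ContDiff ℝ (⊤:ℕ∞) (ZL w f) := by
  induction w with
  | nil => exact hf
  | cons a w ih => exact vf_smooth a ih

theorem ZL_neg_sub {n : ℕ} (w : List (VFIdx n)) {f g : (Fin (n+1) → ℝ) → ℝ}
    (hf : ContDiff ℝ (⊤:ℕ∞) f) (hg : ContDiff ℝ (⊤:ℕ∞) g) :
    ZL w (fun y => -f y - g y) = fun y => - ZL w f y - ZL w g y := by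
  induction w with
  | nil => rfl
  | cons a w ih =>
    change vf a (ZL w _) = fun y => - vf a (ZL w f) y - vf a (ZL w g) y
    rw [ih]
    funext y
    have h1 : DifferentiableAt ℝ (ZL w f) y := (ZL_smooth w hf).differentiable (by simp) y
    have h2 : DifferentiableAt ℝ (ZL w g) y := (ZL_smooth w hg).differentiable (by simp) y
    simp only [vf_eq]
    rw [(h1.hasFDerivAt.fun_neg.fun_sub h2.hasFDerivAt).fderiv]
    simp

/-- Splittings of a word. -/
def spl {α : Type*} : List α → List (List α × List α)
  | [] => [([], [])]
  | a :: w => (spl w).map (fun p => (a :: p.1, p.2)) ++ (spl w).map (fun p => (p.1, a :: p.2))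

theorem spl_length {α : Type*} (w : List α) : (spl w).length = 2 ^ w.length := by
  induction w with
  | nil => rfl
  | cons a w ih => simp [spl, ih, pow_succ]; ring

theorem spl_mem {α : Type*} (w : List α) : ∀ p ∈ spl w, p.1.length + p.2.length = w.length := by
  induction w with
  | nil => simp [spl]
  | cons a w ih =>
    intro p hp
    simp only [spl, List.mem_append, List.mem_map] at hp
    rcases hp with ⟨q, hq, rfl⟩ | ⟨q, hq, rfl⟩ <;> have := ih q hq <;> simp <;> omega

theorem vf_sum_mul {n : ℕ} (a : VFIdx n) (f g : (Fin (n+1) → ℝ) → ℝ)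
    (hf : ContDiff ℝ (⊤:ℕ∞) f) (hg : ContDiff ℝ (⊤:ℕ∞) g) (y : Fin (n+1) → ℝ)
    (L : List (List (VFIdx n) × List (VFIdx n))) :
    DifferentiableAt ℝ (fun y => (L.map (fun p => ZL p.1 f y * ZL p.2 g y)).sum) y ∧
    vf a (fun y => (L.map (fun p => ZL p.1 f y * ZL p.2 g y)).sum) y =
      ((L.map (fun p => (a :: p.1, p.2)) ++ L.map (fun p => (p.1, a :: p.2))).map
        (fun p => ZL p.1 f y * ZL p.2 g y)).sum := by
  induction L with
  | nil => simp [vf_eq]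
  | cons p L ih =>
    have h1 : DifferentiableAt ℝ (ZL p.1 f) y := (ZL_smooth _ hf).differentiable (by simp) y
    have h2 : DifferentiableAt ℝ (ZL p.2 g) y := (ZL_smooth _ hg).differentiable (by simp) y
    obtain ⟨h3, h4⟩ := ih
    simp only [List.map_cons, List.sum_cons]
    refine ⟨(h1.mul h2).add h3, ?_⟩
    rw [vf_eq] at h4 ⊢
    rw [((h1.hasFDerivAt.fun_mul h2.hasFDerivAt).fun_add h3.hasFDerivAt).fderiv]
    rw [add_apply, h4]
    have e1 : ZL (a :: p.1) f y = fderiv ℝ (ZL p.1 f) y (vV a y) := vf_eq _ _ _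
    have e2 : ZL (a :: p.2) g y = fderiv ℝ (ZL p.2 g) y (vV a y) := vf_eq _ _ _
    simp [e1, e2]
    ring

theorem ZL_mul {n : ℕ} (w : List (VFIdx n)) (f g : (Fin (n+1) → ℝ) → ℝ)
    (hf : ContDiff ℝ (⊤:ℕ∞) f) (hg : ContDiff ℝ (⊤:ℕ∞) g) :
    ZL w (fun y => f y * g y) =
      fun y => ((spl w).map (fun p => ZL p.1 f y * ZL p.2 g y)).sum := by
  induction w with
  | nil => simp [spl, ZL]
  | cons a w ih =>
    change vf a (ZL w _) = _
    rw [ih]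
    funext y
    exact (vf_sum_mul a f g hf hg y (spl w)).2

theorem abs_list_sum {α : Type*} (h : α → ℝ) (B : ℝ) (L : List α) (hL : ∀ p ∈ L, |h p| ≤ B) :
    |(L.map h).sum| ≤ L.length * B := by
  induction L with
  | nil => simp
  | cons p L ih =>
    simp only [List.map_cons, List.sum_cons, List.length_cons]
    have h1 := hL p (by simp)
    have h2 := ih fun q hq => hL q (by simp [hq])
    have := abs_add_le (h p) (L.map h).sum
    push_cast
    linarith

/-- Sum of absolute values of Z-derivatives of order at most `k`. -/
def SS {n : ℕ} (k : ℕ) (f : (Fin (n+1) → ℝ) → ℝ) (y : Fin (n+1) → ℝ) : ℝ :=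
  ∑ l' ∈ Finset.range (k+1), ∑ J : Fin l' → VFIdx n, |Zpow J f y|

theorem SS_nonneg {n : ℕ} (k : ℕ) (f : (Fin (n+1) → ℝ) → ℝ) (y : Fin (n+1) → ℝ) :
    0 ≤ SS k f y := Finset.sum_nonneg fun _ _ => Finset.sum_nonneg fun _ _ => abs_nonneg _

theorem SS_mono {n : ℕ} {k k' : ℕ} (h : k ≤ k') (f : (Fin (n+1) → ℝ) → ℝ) (y : Fin (n+1) → ℝ) :
    SS k f y ≤ SS k' f y :=
  Finset.sum_le_sum_of_subset_of_nonneg (by intro; simp; omega)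
    fun _ _ _ => Finset.sum_nonneg fun _ _ => abs_nonneg _

theorem le_SS {n : ℕ} {k : ℕ} (w : List (VFIdx n)) (hw : w.length ≤ k)
    (f : (Fin (n+1) → ℝ) → ℝ) (y : Fin (n+1) → ℝ) : |ZL w f y| ≤ SS k f y := by
  have h1 : |ZL w f y| = |Zpow w.get f y| := by simp [Zpow, ZL]
  rw [h1]
  refine le_trans ?_ (Finset.single_le_sum (f := fun l' => ∑ J : Fin l' → VFIdx n, |Zpow J f y|)
    (fun _ _ => Finset.sum_nonneg fun _ _ => abs_nonneg _)
    (Finset.mem_range.2 (Nat.lt_succ_of_le hw)))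
  exact Finset.single_le_sum (f := fun J : Fin w.length → VFIdx n => |Zpow J f y|)
    (fun _ _ => abs_nonneg _) (Finset.mem_univ _)

theorem vf_exp {n : ℕ} (a : VFIdx n) (φ : (Fin (n+1) → ℝ) → ℝ) (hφ : ContDiff ℝ (⊤:ℕ∞) φ) :
    vf a (fun y => Real.exp (-(φ y)) - 1) =
      fun y => - ((Real.exp (-(φ y)) - 1) * vf a φ y) - vf a φ y := by
  funext y
  have h1 : DifferentiableAt ℝ φ y := hφ.differentiable (by simp) y
  simp only [vf_eq]
  rw [(h1.hasFDerivAt.fun_neg.exp.sub_const 1).fderiv]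
  simp
  ring

theorem exp_bound (x ν : ℝ) (h : |x| ≤ ν) : |Real.exp (-x) - 1| ≤ Real.exp ν * |x| := by
  have h1 := Real.add_one_le_exp (-x)
  have h2 := Real.add_one_le_exp x
  have h3 : Real.exp (-x) * Real.exp x = 1 := by rw [← Real.exp_add]; simp
  have h4 : Real.exp (-x) ≤ Real.exp ν := Real.exp_le_exp.2 ((neg_le_abs x).trans h)
  have h5 : 1 ≤ Real.exp ν := Real.one_le_exp ((abs_nonneg x).trans h)
  have h6 := Real.exp_pos (-x)
  have h7 := abs_nonneg x
  have h8 := le_abs_self x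
  have h9 := neg_le_abs x
  rw [abs_le]
  constructor
  · nlinarith
  · have : Real.exp (-x) - 1 ≤ Real.exp (-x) * |x| := by nlinarith
    nlinarith

theorem ZL_exp {n : ℕ} (l : ℕ) (ν₀ : ℝ) (hν : 0 < ν₀) (k : ℕ) : k ≤ l →
    ∃ C : ℝ, 0 < C ∧ ∀ φ : (Fin (n+1) → ℝ) → ℝ, ContDiff ℝ (⊤:ℕ∞) φ → ∀ y, SS (l/2) φ y ≤ ν₀ →
      ∀ w : List (VFIdx n), w.length ≤ k →
        |ZL w (fun y => Real.exp (-(φ y)) - 1) y| ≤ C * SS w.length φ y := by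
  induction k with
  | zero =>
    intro _
    refine ⟨Real.exp ν₀, Real.exp_pos _, fun φ hφ y hy w hw => ?_⟩
    have : w = [] := List.length_eq_zero_iff.1 (by omega)
    subst this
    have h1 := le_SS (k := 0) ([] : List (VFIdx n)) (by simp) φ y
    have h2 := (le_SS (k := l/2) ([] : List (VFIdx n)) (by simp) φ y).trans hy
    exact (exp_bound _ _ h2).trans (mul_le_mul_of_nonneg_left h1 (Real.exp_pos _).le)
  | succ k ih =>
    intro hk
    obtain ⟨C, hC, H⟩ := ih (by omega)
    refine ⟨C + (2 ^ k * (C * ν₀) + 1), by positivity, fun φ hφ y hy w hw => ?_⟩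
    have hS := SS_nonneg w.length φ y
    by_cases hwk : w.length ≤ k
    · refine (H φ hφ y hy w hwk).trans (mul_le_mul_of_nonneg_right ?_ hS)
      have : 0 ≤ 2 ^ k * (C * ν₀) := by positivity
      linarith
    have hwl : w.length = k + 1 := by omega
    have hne : w ≠ [] := by rintro rfl; simp at hwl
    obtain ⟨w', a, rfl⟩ : ∃ w' a, w = w' ++ [a] :=
      ⟨w.dropLast, w.getLast hne, (List.dropLast_append_getLast hne).symm⟩
    have hl' : w'.length = k := by simpa using hwl
    have hE : ContDiff ℝ (⊤:ℕ∞) (fun y => Real.exp (-(φ y)) - 1) := by fun_prop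
    have hap : ∀ (v : List (VFIdx n)) f, ZL v (vf a f) = ZL (v ++ [a]) f := by
      intro v f; simp [ZL]
    have key : ZL (w' ++ [a]) (fun y => Real.exp (-(φ y)) - 1) y =
        - ((spl w').map (fun p => ZL p.1 (fun y => Real.exp (-(φ y)) - 1) y *
            ZL p.2 (vf a φ) y)).sum - ZL (w' ++ [a]) φ y := by
      rw [← hap, vf_exp a φ hφ, ZL_neg_sub w' (hE.mul (vf_smooth a hφ)) (vf_smooth a hφ),
        ZL_mul _ _ _ hE (vf_smooth a hφ), hap]
    rw [key]
    have hb := abs_list_sum (fun p => ZL p.1 (fun y => Real.exp (-(φ y)) - 1) y *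
            ZL p.2 (vf a φ) y) (C * ν₀ * SS (w' ++ [a]).length φ y) (spl w') (by
      intro p hp
      have hp' := spl_mem w' p hp
      have h1 := H φ hφ y hy p.1 (by omega)
      rw [abs_mul, hap]
      have h2 : |ZL (p.2 ++ [a]) φ y| ≤ SS (w' ++ [a]).length φ y :=
        le_SS _ (by simp; omega) _ _
      have h0 := SS_nonneg p.1.length φ y
      by_cases hc : p.1.length ≤ l/2
      · have h3 := (SS_mono hc φ y).trans hy
        calc _ ≤ (C * SS p.1.length φ y) * SS (w' ++ [a]).length φ y := by gcongr
          _ ≤ _ := by gcongr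
      · have h3 : |ZL (p.2 ++ [a]) φ y| ≤ ν₀ := (le_SS _ (by simp; omega) _ _).trans hy
        have h4 : SS p.1.length φ y ≤ SS (w' ++ [a]).length φ y :=
          SS_mono (by simp; omega) _ _
        calc _ ≤ (C * SS p.1.length φ y) * ν₀ := by gcongr
          _ ≤ (C * SS (w' ++ [a]).length φ y) * ν₀ := by gcongr
          _ = _ := by ring)
    rw [spl_length, hl'] at hb
    have hf := le_SS (w' ++ [a]) le_rfl φ y
    have habs : ∀ A B : ℝ, |-A - B| ≤ |A| + |B| := fun A B => by
      simpa using abs_sub (-A) B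
    refine (habs _ _).trans ?_
    push_cast at hb
    have : 0 ≤ C * SS (w' ++ [a]).length φ y := by positivity
    linarith

theorem main_pt {n : ℕ} (l : ℕ) (ν₀ : ℝ) (hν : 0 < ν₀) :
    ∃ C : ℝ≥0, 0 < C ∧ ∀ φ ψ : (Fin (n+1) → ℝ) → ℝ, ContDiff ℝ (⊤:ℕ∞) φ → ContDiff ℝ (⊤:ℕ∞) ψ →
      ∀ y, SS (l/2) φ y ≤ ν₀ → ∀ I : Fin l → VFIdx n,
        |Zpow I (fun y => (Real.exp (-(φ y)) - 1) * ψ y) y| ≤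
          C * (SS l φ y * SS ((l-1)/2) ψ y + SS l ψ y * SS (l/2) φ y) := by
  obtain ⟨C, hC, H⟩ := ZL_exp (n := n) l ν₀ hν l le_rfl
  have hC' : 0 < 2 ^ l * C := by positivity
  refine ⟨Real.toNNReal (2 ^ l * C), Real.toNNReal_pos.2 hC', fun φ ψ hφ hψ y hy I => ?_⟩
  rw [Real.coe_toNNReal _ hC'.le]
  change |ZL (List.ofFn I) _ y| ≤ 2 ^ l * C * _
  have hE : ContDiff ℝ (⊤:ℕ∞) (fun y => Real.exp (-(φ y)) - 1) := by fun_prop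
  rw [ZL_mul _ _ _ hE hψ]
  have hb := abs_list_sum (fun p => ZL p.1 (fun y => Real.exp (-(φ y)) - 1) y *
            ZL p.2 ψ y)
      (C * (SS l φ y * SS ((l-1)/2) ψ y + SS l ψ y * SS (l/2) φ y)) (spl (List.ofFn I)) (by
    intro p hp
    have hp' := spl_mem _ p hp
    rw [List.length_ofFn] at hp'
    have h1 := H φ hφ y hy p.1 (by omega)
    rw [abs_mul]
    have n1 := SS_nonneg p.1.length φ y
    have n2 := mul_nonneg (SS_nonneg l φ y) (SS_nonneg ((l-1)/2) ψ y)
    have n3 := mul_nonneg (SS_nonneg l ψ y) (SS_nonneg (l/2) φ y)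
    by_cases hc : p.1.length ≤ l/2
    · have h3 := SS_mono hc φ y
      have h4 : |ZL p.2 ψ y| ≤ SS l ψ y := le_SS _ (by omega) _ _
      have n4 := SS_nonneg (l/2) φ y
      calc _ ≤ (C * SS (l/2) φ y) * SS l ψ y := by gcongr; exact h1.trans (by gcongr)
        _ = C * (0 + SS l ψ y * SS (l/2) φ y) := by ring
        _ ≤ _ := by gcongr
    · have h3 : SS p.1.length φ y ≤ SS l φ y := SS_mono (by omega) φ y
      have h4 : |ZL p.2 ψ y| ≤ SS ((l-1)/2) ψ y := le_SS _ (by omega) _ _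
      have n4 := SS_nonneg l φ y
      calc _ ≤ (C * SS l φ y) * SS ((l-1)/2) ψ y := by gcongr; exact h1.trans (by gcongr)
        _ = C * (SS l φ y * SS ((l-1)/2) ψ y + 0) := by ring
        _ ≤ _ := by gcongr)
  rw [spl_length, List.length_ofFn] at hb
  push_cast at hb
  rw [mul_assoc]
  exact hb

theorem cont_slice {n : ℕ} {f : (Fin (n+1) → ℝ) → ℝ} (hf : Continuous f) (t : ℝ) :
    AEStronglyMeasurable (fun x : Fin n → ℝ => f (Fin.cons t x)) volume := by
  refine Continuous.aestronglyMeasurable (hf.comp ?_)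
  refine continuous_pi fun j => ?_
  refine Fin.cases ?_ (fun j => ?_) j
  · simpa using continuous_const
  · simpa using continuous_apply j

theorem Zpow_cont {n l : ℕ} (J : Fin l → VFIdx n) {f : (Fin (n+1) → ℝ) → ℝ}
    (hf : ContDiff ℝ (⊤:ℕ∞) f) : Continuous (Zpow J f) := (ZL_smooth (List.ofFn J) hf).continuous

theorem sliceNorm_sum_le {n : ℕ} {ι : Type*} (s : Finset ι) (f : ι → (Fin (n+1) → ℝ) → ℝ)
    (hf : ∀ i ∈ s, Continuous (f i)) (t : ℝ) :
    sliceNorm (fun y => ∑ i ∈ s, f i y) t 2 ≤ ∑ i ∈ s, sliceNorm (f i) t 2 := by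
  have := eLpNorm_sum_le (μ := (volume : Measure (Fin n → ℝ))) (p := 2) (s := s)
    (f := fun i x => f i (Fin.cons t x)) (fun i hi => cont_slice (hf i hi) t) (by norm_num)
  refine le_trans (le_of_eq ?_) this
  unfold sliceNorm
  congr 1
  ext x
  simp

theorem SS_prod {n : ℕ} (k k' : ℕ) {f g : (Fin (n+1) → ℝ) → ℝ} (hf : ContDiff ℝ (⊤:ℕ∞) f)
    (hg : ContDiff ℝ (⊤:ℕ∞) g) (t : ℝ) :
    sliceNorm (fun y => SS k f y * SS k' g y) t 2 ≤
      ∑ l₁ ∈ Finset.range (k + 1), ∑ I₁ : Fin l₁ → VFIdx n,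
        ∑ l₂ ∈ Finset.range (k' + 1), ∑ I₂ : Fin l₂ → VFIdx n,
          sliceNorm (Zpow I₁ f) t 2 * sliceNorm (Zpow I₂ g) t ⊤ := by
  have hc : ∀ {l₁ l₂ : ℕ} (I₁ : Fin l₁ → VFIdx n) (I₂ : Fin l₂ → VFIdx n),
      Continuous (fun y => |Zpow I₁ f y| * |Zpow I₂ g y|) := fun I₁ I₂ =>
    (Zpow_cont I₁ hf).abs.mul (Zpow_cont I₂ hg).abs
  simp only [SS, Finset.sum_mul]
  simp only [Finset.mul_sum]
  refine (sliceNorm_sum_le _ _ (fun _ _ => ?_) t).trans (Finset.sum_le_sum fun l₁ _ => ?_)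
  · exact continuous_finsetSum _ fun _ _ => continuous_finsetSum _ fun _ _ =>
      continuous_finsetSum _ fun _ _ => hc _ _
  refine (sliceNorm_sum_le _ _ (fun _ _ => ?_) t).trans (Finset.sum_le_sum fun I₁ _ => ?_)
  · exact continuous_finsetSum _ fun _ _ =>
      continuous_finsetSum _ fun _ _ => hc _ _
  refine (sliceNorm_sum_le _ _ (fun _ _ => ?_) t).trans (Finset.sum_le_sum fun l₂ _ => ?_)
  · exact continuous_finsetSum _ fun _ _ => hc _ _
  refine (sliceNorm_sum_le _ _ (fun _ _ => hc _ _) t).trans (Finset.sum_le_sum fun I₂ _ => ?_)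
  have := eLpNorm_le_eLpNorm_mul_eLpNorm_top (μ := (volume : Measure (Fin n → ℝ))) 2
    (cont_slice (Zpow_cont I₁ hf) t) (fun x : Fin n → ℝ => Zpow I₂ g (Fin.cons t x))
    (fun a b => |a| * |b|) 1 (.of_forall fun x => by simp)
  simpa [sliceNorm] using this

theorem SS_ae {n : ℕ} (k : ℕ) (f : (Fin (n+1) → ℝ) → ℝ) (t ν₀ : ℝ) (hν : 0 < ν₀)
    (h : ∑ l' ∈ Finset.range (k + 1), ∑ J : Fin l' → VFIdx n,
          sliceNorm (Zpow J f) t ⊤ ≤ ENNReal.ofReal ν₀) :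
    ∀ᵐ x : Fin n → ℝ, SS k f (Fin.cons t x) ≤ ν₀ := by
  have h1 : ∀ᵐ x : Fin n → ℝ, ∀ l' : ℕ, ∀ J : Fin l' → VFIdx n,
      ‖Zpow J f (Fin.cons t x)‖ₑ ≤ sliceNorm (Zpow J f) t ⊤ := by
    refine ae_all_iff.2 fun l' => ae_all_iff.2 fun J => ?_
    unfold sliceNorm
    rw [eLpNorm_exponent_top]
    exact ae_le_eLpNormEssSup
  filter_upwards [h1] with x hx
  rw [← ENNReal.ofReal_le_ofReal_iff hν.le]
  refine le_trans ?_ h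
  unfold SS
  rw [ENNReal.ofReal_sum_of_nonneg fun _ _ => Finset.sum_nonneg fun _ _ => abs_nonneg _]
  refine Finset.sum_le_sum fun l' _ => ?_
  rw [ENNReal.ofReal_sum_of_nonneg fun _ _ => abs_nonneg _]
  refine Finset.sum_le_sum fun J _ => ?_
  rw [← Real.enorm_eq_ofReal_abs]
  exact hx l' J

theorem SS_cont {n : ℕ} (k : ℕ) {f : (Fin (n+1) → ℝ) → ℝ} (hf : ContDiff ℝ (⊤:ℕ∞) f) :
    Continuous (SS k f) :=
  continuous_finsetSum _ fun _ _ => continuous_finsetSum _ fun J _ => (Zpow_cont J hf).abs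

/-- Product estimate: `‖Z^I((e^{−φ} − 1) ∂_i φ)‖_{L²}` is bounded by mixed
`L² × L^∞` sums of `Z`-derivatives of `φ` and `∂_i φ`, assuming the low-order
`Z`-derivatives of `φ` are uniformly bounded by `ν₀`. -/
theorem stmt_7 (n l : ℕ) (T ν₀ : ℝ) (hT : 0 ≤ T) (hν : 0 < ν₀) (i : Fin (n+1)) :
    ∃ C : ℝ≥0, 0 < C ∧ ∀ φ : (Fin (n+1) → ℝ) → ℝ, ContDiff ℝ (⊤:ℕ∞) φ →
      (∀ t ∈ Set.Icc 0 T,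
        ∑ l' ∈ Finset.range (l/2 + 1), ∑ J : Fin l' → VFIdx n,
          sliceNorm (Zpow J φ) t ⊤ ≤ ENNReal.ofReal ν₀) →
      ∀ I : Fin l → VFIdx n, ∀ t ∈ Set.Icc 0 T,
        sliceNorm (Zpow I (fun y => (Real.exp (-(φ y)) - 1) * pd i φ y)) t 2 ≤
          C * ((∑ l₁ ∈ Finset.range (l + 1), ∑ I₁ : Fin l₁ → VFIdx n,
                  ∑ l₂ ∈ Finset.range ((l - 1)/2 + 1), ∑ I₂ : Fin l₂ → VFIdx n,
                    sliceNorm (Zpow I₁ φ) t 2 * sliceNorm (Zpow I₂ (pd i φ)) t ⊤)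
            + (∑ l₂ ∈ Finset.range (l + 1), ∑ I₂ : Fin l₂ → VFIdx n,
                  ∑ l₁ ∈ Finset.range (l/2 + 1), ∑ I₁ : Fin l₁ → VFIdx n,
                    sliceNorm (Zpow I₁ φ) t ⊤ * sliceNorm (Zpow I₂ (pd i φ)) t 2)) := by
  obtain ⟨C, hC, H⟩ := main_pt (n := n) l ν₀ hν
  refine ⟨C, hC, fun φ hφ hb I t ht => ?_⟩
  have hψ : ContDiff ℝ (⊤:ℕ∞) (pd i φ) := vf_smooth (Sum.inl i) hφ
  have hae := SS_ae (l/2) φ t ν₀ hν (hb t ht)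
  have h1 : sliceNorm (Zpow I (fun y => (Real.exp (-(φ y)) - 1) * pd i φ y)) t 2 ≤
      C • sliceNorm (fun y => SS l φ y * SS ((l-1)/2) (pd i φ) y
        + SS l (pd i φ) y * SS (l/2) φ y) t 2 := by
    refine eLpNorm_le_nnreal_smul_eLpNorm_of_ae_le_mul ?_ 2
    filter_upwards [hae] with x hx
    rw [← NNReal.coe_le_coe]
    push_cast
    refine (H φ (pd i φ) hφ hψ _ hx I).trans ?_
    exact mul_le_mul_of_nonneg_left (le_abs_self _) C.2
  refine h1.trans ?_
  rw [ENNReal.smul_def, smul_eq_mul]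
  refine mul_le_mul_right ?_ _
  have h2 : sliceNorm (fun y => SS l φ y * SS ((l-1)/2) (pd i φ) y
        + SS l (pd i φ) y * SS (l/2) φ y) t 2 ≤
      sliceNorm (fun y => SS l φ y * SS ((l-1)/2) (pd i φ) y) t 2
        + sliceNorm (fun y => SS l (pd i φ) y * SS (l/2) φ y) t 2 :=
    eLpNorm_add_le (cont_slice ((SS_cont _ hφ).mul (SS_cont _ hψ)) t)
      (cont_slice ((SS_cont _ hψ).mul (SS_cont _ hφ)) t) (by norm_num)
  refine h2.trans (add_le_add (SS_prod _ _ hφ hψ t) ((SS_prod _ _ hψ hφ t).trans (le_of_eq ?_)))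
  simp only [mul_comm]
end
end

section
/- For t, |x|, r > 0, define H(t,|x|,r) = ∫_{−φ}^{φ} (t² − |x|² − r² + 2|x|r cos ψ)^{−1/2} dψ with φ = arccos((|x|² + r² − t²)/(2|x|r)) when |(|x|² + r² − t²)/(2|x|r)| ≤ 1, and H(t,|x|,r) = ∫_{−π}^{π} (t² − |x|² − r² + 2|x|r cos ψ)^{−1/2} dψ when |(|x|² + r² − t²)/(2|x|r)| ≥ 1. If t ≥ |x| + r and |(|x|² + r² − t²)/(2|x|r)| ≥ 1, then there is an absolute constant C such that H(t,|x|,r) ≤ C ln(2 + r|x|/(t² − (r+|x|)²)) / √(t² − |x|² − r²). -/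
open MeasureTheory Real NNReal ENNReal

noncomputable section

lemma aux_lower (x : ℝ) (hx : |x| ≤ Real.pi) :
    2 / Real.pi ^ 2 * x ^ 2 ≤ 1 - Real.cos x := by
  have := Real.cos_le_one_sub_mul_cos_sq hx
  linarith

lemma aux_notint (B : ℝ) (hB : 0 < B) :
    ¬ IntervalIntegrable (fun ψ => 1 / Real.sqrt (B + B * Real.cos ψ)) volume
      (-Real.pi) Real.pi := by
  have hpi := Real.pi_pos
  apply not_intervalIntegrable_of_sub_inv_isBigO_punctured (c := Real.pi)
  · apply Asymptotics.IsBigO.of_bound (Real.sqrt B)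
    have h1 : ∀ᶠ x in nhdsWithin Real.pi {Real.pi}ᶜ, x ∈ Metric.ball Real.pi Real.pi :=
      nhdsWithin_le_nhds (Metric.ball_mem_nhds _ hpi)
    filter_upwards [h1, self_mem_nhdsWithin] with x hx hne
    rw [Metric.mem_ball, Real.dist_eq] at hx
    have hne' : x - Real.pi ≠ 0 := sub_ne_zero.mpr hne
    have hl := aux_lower (x - Real.pi) hx.le
    have hu := Real.one_sub_sq_div_two_le_cos (x := x - Real.pi)
    rw [Real.cos_sub_pi] at hl hu
    have hp : 0 < (x - Real.pi) ^ 2 := by positivity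
    have hq : 0 < 2 / Real.pi ^ 2 * (x - Real.pi) ^ 2 := by positivity
    have hc : 0 < 1 + Real.cos x := by linarith
    have hS : 0 < Real.sqrt (B + B * Real.cos x) := Real.sqrt_pos.mpr (by nlinarith)
    rw [Real.norm_eq_abs, Real.norm_eq_abs, abs_inv, abs_of_pos (one_div_pos.mpr hS),
      mul_one_div, inv_le_comm₀ (abs_pos.mpr hne') (by positivity), inv_div,
      div_le_iff₀ (by positivity), ← Real.sqrt_sq_eq_abs,
      ← Real.sqrt_mul (by positivity)]
    apply Real.sqrt_le_sqrt
    nlinarith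
  · linarith
  · exact Set.right_mem_uIcc

lemma aux_int (a k : ℝ) (ha : 0 < a) (hk : 0 < k) :
    IntervalIntegrable (fun ψ => Real.sqrt 2 / (a + k * (Real.pi - ψ))) volume 0 Real.pi ∧
    ∫ ψ in (0:ℝ)..Real.pi, Real.sqrt 2 / (a + k * (Real.pi - ψ)) =
      Real.sqrt 2 / k * Real.log (1 + k * Real.pi / a) := by
  have hpi := Real.pi_pos
  have hpos : ∀ x ∈ Set.uIcc 0 Real.pi, 0 < a + k * (Real.pi - x) := by
    intro x hx
    rw [Set.uIcc_of_le hpi.le] at hx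
    have := mul_nonneg hk.le (sub_nonneg.mpr hx.2)
    linarith
  have hi : IntervalIntegrable (fun ψ => Real.sqrt 2 / (a + k * (Real.pi - ψ))) volume 0 Real.pi := by
    apply ContinuousOn.intervalIntegrable
    apply ContinuousOn.div (by fun_prop) (by fun_prop)
    intro x hx
    exact (hpos x hx).ne'
  refine ⟨hi, ?_⟩
  rw [intervalIntegral.integral_eq_sub_of_hasDerivAt
    (f := fun x => - (Real.sqrt 2 / k * Real.log (a + k * (Real.pi - x)))) ?_ hi]
  · have : 1 + k * Real.pi / a = (a + k * Real.pi) / a := by field_simp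
    rw [this, Real.log_div (by positivity) ha.ne']
    simp
    ring
  · intro x hx
    have h := hpos x hx
    have h1 : HasDerivAt (fun x => a + k * (Real.pi - x)) (k * (-1)) x := by
      simpa using (((hasDerivAt_id x).const_sub Real.pi).const_mul k).const_add a
    have := ((h1.log h.ne').const_mul (Real.sqrt 2 / k)).neg
    have hE : -(Real.sqrt 2 / k * (k * -1 / (a + k * (Real.pi - x)))) =
        Real.sqrt 2 / (a + k * (Real.pi - x)) := by
      have h' := h.ne'
      generalize a + k * (Real.pi - x) = z at h'
      field_simp
    rw [hE] at this
    exact this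

lemma aux_log (y : ℝ) (hy : 0 ≤ y) :
    Real.log (1 + Real.sqrt (2 * y)) ≤ Real.log (2 + y / 2) := by
  apply Real.log_le_log (by positivity)
  have h := Real.sq_sqrt (show 0 ≤ 2 * y by positivity)
  nlinarith [sq_nonneg (Real.sqrt (2 * y) - 2)]

lemma aux_main (d B : ℝ) (hd : 0 < d) (hB : 0 < B) :
    (∫ ψ in (-Real.pi)..Real.pi, 1 / Real.sqrt (d + B + B * Real.cos ψ)) ≤
      20 * Real.log (2 + B / d / 2) / Real.sqrt (d + B) := by
  have hpi := Real.pi_pos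
  have hge : ∀ ψ, d ≤ d + B + B * Real.cos ψ := fun ψ => by
    nlinarith [Real.neg_one_le_cos ψ]
  have hcont : Continuous fun ψ => 1 / Real.sqrt (d + B + B * Real.cos ψ) := by
    apply Continuous.div (by fun_prop) (by fun_prop)
    intro x
    exact (Real.sqrt_pos.mpr (hd.trans_le (hge x))).ne'
  have hII := fun a b => hcont.intervalIntegrable (μ := volume) a b
  have hl2 : 0.69 < Real.log (2 + B / d / 2) := by
    have h1 := Real.log_two_gt_d9
    have h2 : Real.log 2 ≤ Real.log (2 + B / d / 2) :=
      Real.log_le_log (by norm_num) (by have : 0 < B / d / 2 := by positivity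
                                        linarith)
    linarith
  have hs2 : Real.sqrt 2 < 1.42 := by
    rw [Real.sqrt_lt' (by norm_num)]; norm_num
  have hs2p : 0 < Real.sqrt 2 := by positivity
  have hpi2 := Real.pi_lt_d2
  have hA : 0 < Real.sqrt (d + B) := by positivity
  set L := Real.log (2 + B / d / 2) with hL
  rcases le_total B d with h | h
  · have hb : ∀ ψ ∈ Set.Icc (-Real.pi) Real.pi,
        1 / Real.sqrt (d + B + B * Real.cos ψ) ≤ Real.sqrt 2 / Real.sqrt (d + B) := by
      intro ψ _
      rw [div_le_div_iff₀ (Real.sqrt_pos.mpr (hd.trans_le (hge ψ))) hA, one_mul,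
        ← Real.sqrt_mul (by norm_num)]
      apply Real.sqrt_le_sqrt
      linarith [hge ψ]
    have := intervalIntegral.integral_mono_on (by linarith) (hII _ _)
      (intervalIntegrable_const (μ := volume)) hb
    refine this.trans ?_
    rw [intervalIntegral.integral_const, smul_eq_mul, ← mul_div_assoc]
    apply div_le_div_of_nonneg_right _ hA.le
    nlinarith
  · have hsplit := intervalIntegral.integral_add_adjacent_intervals (hII (-Real.pi) 0) (hII 0 Real.pi)
    have hneg : (∫ ψ in (-Real.pi)..0, 1 / Real.sqrt (d + B + B * Real.cos ψ)) =
        ∫ ψ in (0:ℝ)..Real.pi, 1 / Real.sqrt (d + B + B * Real.cos ψ) := by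
      have := intervalIntegral.integral_comp_neg (a := 0) (b := Real.pi)
        (fun ψ => 1 / Real.sqrt (d + B + B * Real.cos ψ))
      simpa using this.symm
    have hk : 0 < Real.sqrt (2 * B) / Real.pi := by positivity
    have ha : 0 < Real.sqrt d := by positivity
    obtain ⟨hi, he⟩ := aux_int _ _ ha hk
    have hb : ∀ ψ ∈ Set.Icc 0 Real.pi, 1 / Real.sqrt (d + B + B * Real.cos ψ) ≤
        Real.sqrt 2 / (Real.sqrt d + Real.sqrt (2 * B) / Real.pi * (Real.pi - ψ)) := by
      intro ψ hψ
      have hx : 0 ≤ Real.pi - ψ := sub_nonneg.mpr hψ.2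
      have hl := aux_lower (Real.pi - ψ) (by rw [abs_of_nonneg hx]; linarith [hψ.1])
      rw [Real.cos_pi_sub] at hl
      rw [div_le_div_iff₀ (Real.sqrt_pos.mpr (hd.trans_le (hge ψ))) (by positivity), one_mul,
        ← Real.sqrt_mul (by norm_num)]
      apply Real.le_sqrt_of_sq_le
      set v := Real.sqrt (2 * B) / Real.pi * (Real.pi - ψ) with hv
      have hv2 : v ^ 2 = B * (2 / Real.pi ^ 2 * (Real.pi - ψ) ^ 2) := by
        rw [hv, mul_pow, div_pow, Real.sq_sqrt (by positivity)]; ring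
      have hd2 := Real.sq_sqrt hd.le
      have := mul_le_mul_of_nonneg_left hl hB.le
      nlinarith [sq_nonneg (Real.sqrt d - v)]
    have hm := intervalIntegral.integral_mono_on hpi.le (hII _ _) hi hb
    rw [he] at hm
    have e1 : Real.sqrt (2 * B) / Real.pi * Real.pi / Real.sqrt d = Real.sqrt (2 * (B / d)) := by
      rw [div_mul_cancel₀ _ hpi.ne', ← Real.sqrt_div (by positivity), mul_div_assoc]
    have e2 : Real.sqrt 2 / (Real.sqrt (2 * B) / Real.pi) = Real.pi / Real.sqrt B := by
      rw [Real.sqrt_mul (by norm_num)]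
      field_simp
    rw [e1, e2] at hm
    have hlog := aux_log (B / d) (by positivity)
    have hBs : 0 < Real.sqrt B := by positivity
    have h3 : Real.pi / Real.sqrt B ≤ Real.pi * Real.sqrt 2 / Real.sqrt (d + B) := by
      rw [div_le_div_iff₀ hBs hA, mul_assoc, ← Real.sqrt_mul (by norm_num)]
      gcongr
      linarith
    have h4 : Real.pi / Real.sqrt B * Real.log (1 + Real.sqrt (2 * (B / d))) ≤
        Real.pi * Real.sqrt 2 / Real.sqrt (d + B) * L :=
      (mul_le_mul_of_nonneg_left hlog (by positivity)).trans
        (mul_le_mul_of_nonneg_right h3 (by linarith))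
    rw [← hsplit, hneg]
    have h5 : Real.pi * Real.sqrt 2 ≤ 10 := by nlinarith
    have h6 : Real.pi * Real.sqrt 2 / Real.sqrt (d + B) * L ≤ 10 / Real.sqrt (d + B) * L := by
      gcongr
    have h7 : 20 * L / Real.sqrt (d + B) = 2 * (10 / Real.sqrt (d + B) * L) := by ring
    rw [h7]
    linarith

/-- Kovalyov's estimate, case I: if `t ≥ |x| + r` and
`|(|x|² + r² − t²)/(2|x|r)| ≥ 1`, the angular integral `H(t,|x|,r)` is bounded by
`C ln(2 + r|x|/(t² − (r+|x|)²)) / √(t² − |x|² − r²)`.  (`R` stands for `|x|`.) -/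
theorem stmt_9 :
    ∃ C : ℝ, 0 < C ∧ ∀ t R r : ℝ, 0 < t → 0 < R → 0 < r →
      R + r ≤ t → 1 ≤ |(R^2 + r^2 - t^2) / (2*R*r)| →
      (∫ ψ in (-Real.pi)..Real.pi,
          1 / Real.sqrt (t^2 - R^2 - r^2 + 2*R*r*Real.cos ψ)) ≤
        C * Real.log (2 + r*R / (t^2 - (r+R)^2)) / Real.sqrt (t^2 - R^2 - r^2) := by
  refine ⟨20, by norm_num, ?_⟩
  intro t R r ht hR hr hle _
  have hRr : 0 < 2 * R * r := by positivity
  rcases hle.eq_or_lt with h | h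
  · have e : t ^ 2 - R ^ 2 - r ^ 2 = 2 * R * r := by rw [← h]; ring
    rw [e, intervalIntegral.integral_undef (aux_notint _ hRr)]
    have e0 : t ^ 2 - (r + R) ^ 2 = 0 := by rw [← h]; ring
    rw [e0, _root_.div_zero, add_zero]
    have := Real.log_pos (show (1:ℝ) < 2 by norm_num)
    positivity
  · have hd : 0 < t ^ 2 - (r + R) ^ 2 := by nlinarith
    have := aux_main _ _ hd hRr
    have e : t ^ 2 - (r + R) ^ 2 + 2 * R * r = t ^ 2 - R ^ 2 - r ^ 2 := by ring
    have e2 : 2 * R * r / (t ^ 2 - (r + R) ^ 2) / 2 = r * R / (t ^ 2 - (r + R) ^ 2) := by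
      field_simp
    rw [e, e2] at this
    exact this
end
end

section
/- For t, |x|, r > 0, define H(t,|x|,r) = ∫_{−φ}^{φ} (t² − |x|² − r² + 2|x|r cos ψ)^{−1/2} dψ with φ = arccos((|x|² + r² − t²)/(2|x|r)) when |(|x|² + r² − t²)/(2|x|r)| ≤ 1, and H(t,|x|,r) = ∫_{−π}^{π} (t² − |x|² − r² + 2|x|r cos ψ)^{−1/2} dψ when |(|x|² + r² − t²)/(2|x|r)| ≥ 1. If t ≤ |x| + r and |(|x|² + r² − t²)/(2|x|r)| ≤ 1, then there is an absolute constant C such that H(t,|x|,r) ≤ (C/√(r|x|)) · ln(2 + r|x| χ(t−|x|)/((r+|x|)² − t²)), where χ is the characteristic function of the positive real numbers. -/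
open MeasureTheory Real NNReal ENNReal

noncomputable section

lemma aux_int_s10 {φ c : ℝ} (hφ : 0 < φ) (hc : 0 ≤ c) (f F g : ℝ → ℝ)
    (hF : ContinuousOn F (Set.Icc (-φ) φ))
    (hF' : ∀ x ∈ Set.Ioo (-φ) φ, HasDerivAt F (g x) x)
    (hg : ∀ x ∈ Set.Ioo (-φ) φ, 0 ≤ g x)
    (hf0 : ∀ x, 0 ≤ f x) (hfe : ∀ x, f (-x) = f x)
    (hf : ∀ x ∈ Set.Ico 0 φ, f x ≤ c * g x) :
    ∫ x in (-φ)..φ, f x ≤ 2 * c * (F φ - F (-φ)) := by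
  have hle : -φ ≤ φ := by linarith
  have hneg : ∀ x ∈ Set.Ioo (-φ) φ, -x ∈ Set.Ioo (-φ) φ := fun x hx =>
    ⟨by linarith [hx.2], by linarith [hx.1]⟩
  set G : ℝ → ℝ := fun x => c * (F x - F (-x)) with hG
  have hGc : ContinuousOn G (Set.Icc (-φ) φ) := by
    refine continuousOn_const.mul (hF.sub (hF.comp continuous_neg.continuousOn ?_))
    intro x hx
    exact ⟨by linarith [hx.2], by linarith [hx.1]⟩
  have hGd : ∀ x ∈ Set.Ioo (-φ) φ, HasDerivAt G (c * (g x + g (-x))) x := by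
    intro x hx
    have h2 : HasDerivAt (fun y => F (-y)) (g (-x) * (-1)) x :=
      HasDerivAt.comp x (hF' (-x) (hneg x hx)) (hasDerivAt_neg x)
    have := ((hF' x hx).sub h2).const_mul c
    refine this.congr_deriv ?_
    ring
  have hGn : ∀ x ∈ Set.Ioo (-φ) φ, 0 ≤ c * (g x + g (-x)) := fun x hx =>
    mul_nonneg hc (add_nonneg (hg x hx) (hg _ (hneg x hx)))
  have hint : IntervalIntegrable (fun x => c * (g x + g (-x))) volume (-φ) φ := by
    rw [intervalIntegrable_iff_integrableOn_Ioc_of_le hle]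
    exact intervalIntegral.integrableOn_deriv_of_nonneg hGc hGd hGn
  have heq := intervalIntegral.integral_eq_sub_of_hasDerivAt_of_le hle hGc hGd hint
  have hfin : 2 * c * (F φ - F (-φ)) = G φ - G (-φ) := by
    simp only [hG, neg_neg]; ring
  rw [hfin, ← heq, intervalIntegral.integral_of_le hle, intervalIntegral.integral_of_le hle,
    integral_Ioc_eq_integral_Ioo, integral_Ioc_eq_integral_Ioo]
  refine integral_mono_of_nonneg (Filter.Eventually.of_forall hf0) ?_ ?_
  · exact (((intervalIntegrable_iff_integrableOn_Ioc_of_le hle).1 hint).mono_set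
      Set.Ioo_subset_Ioc_self)
  · refine (ae_restrict_iff' measurableSet_Ioo).2 (Filter.Eventually.of_forall ?_)
    intro x hx
    rcases le_total 0 x with h | h
    · have h1 := hf x ⟨h, hx.2⟩
      have h2 := mul_nonneg hc (hg _ (hneg x hx))
      simp only; linarith
    · have h1 := hf (-x) ⟨by linarith, by linarith [hx.1]⟩
      have h2 := mul_nonneg hc (hg _ hx)
      rw [hfe] at h1
      simp only; linarith

lemma cos_sub_prod (φ ψ : ℝ) :
    Real.cos ψ - Real.cos φ = 2 * (Real.sin ((φ + ψ)/2) * Real.sin ((φ - ψ)/2)) := by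
  rw [Real.cos_sub_cos, show (ψ + φ)/2 = (φ+ψ)/2 by ring, show (ψ - φ)/2 = -((φ-ψ)/2) by ring,
    Real.sin_neg]
  ring

lemma case_one {φ : ℝ} (hφ : 0 < φ) (h2 : φ ≤ π/2) :
    ∫ ψ in (-φ)..φ, 1 / Real.sqrt (Real.cos ψ - Real.cos φ) ≤ 4 * π := by
  have hpi := Real.pi_pos
  have key := aux_int_s10 (c := π / Real.sqrt (2*φ)) hφ (by positivity)
    (fun ψ => 1 / Real.sqrt (Real.cos ψ - Real.cos φ))
    (fun ψ => -2 * Real.sqrt (φ - ψ)) (fun ψ => 1 / Real.sqrt (φ - ψ))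
    (by fun_prop) ?_ (fun x _ => by positivity) (fun x => by positivity)
    (fun x => by simp only [Real.cos_neg]) ?_
  · refine key.trans (le_of_eq ?_)
    have : 0 < Real.sqrt (2*φ) := Real.sqrt_pos.2 (by linarith)
    simp only [sub_self, Real.sqrt_zero, sub_neg_eq_add, ← two_mul]
    field_simp
    ring
  · intro x hx
    have hs : 0 < φ - x := by linarith [hx.2]
    have h := ((((hasDerivAt_id x).const_sub φ).sqrt hs.ne').const_mul (-2))
    refine h.congr_deriv ?_
    have : 0 < Real.sqrt (φ - x) := Real.sqrt_pos.2 hs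
    try simp only [id]
    field_simp
  · rintro x ⟨hx0, hx1⟩
    have hs : 0 < φ - x := by linarith
    have hA : φ/π ≤ Real.sin ((φ + x)/2) := by
      refine le_trans ?_ (Real.mul_le_sin (by linarith) (by linarith))
      rw [div_le_iff₀ hpi]; field_simp; linarith
    have hB : (φ - x)/π ≤ Real.sin ((φ - x)/2) := by
      refine le_trans (le_of_eq ?_) (Real.mul_le_sin (by linarith) (by linarith))
      field_simp
    have hm : 2*φ*(φ-x)/π^2 ≤ Real.cos x - Real.cos φ := by
      rw [cos_sub_prod]
      have := mul_le_mul hA hB (by positivity) ((by positivity : (0:ℝ) ≤ φ/π).trans hA)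
      calc _ = 2 * (φ/π * ((φ-x)/π)) := by field_simp
        _ ≤ _ := by linarith
    have hpos : 0 < 2*φ*(φ-x)/π^2 := by positivity
    calc 1 / Real.sqrt (Real.cos x - Real.cos φ) ≤ 1 / Real.sqrt (2*φ*(φ-x)/π^2) :=
          one_div_le_one_div_of_le (Real.sqrt_pos.2 hpos) (Real.sqrt_le_sqrt hm)
      _ = _ := by
          rw [Real.sqrt_div (by positivity), Real.sqrt_sq hpi.le, Real.sqrt_mul (by positivity)]
          have h1 : 0 < Real.sqrt (2*φ) := Real.sqrt_pos.2 (by linarith)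
          have h2 : 0 < Real.sqrt (φ-x) := Real.sqrt_pos.2 hs
          field_simp

lemma case_two {φ : ℝ} (hφ : φ < π) (h2 : π/2 ≤ φ) :
    ∫ ψ in (-φ)..φ, 1 / Real.sqrt (Real.cos ψ - Real.cos φ) ≤
      8 * Real.log (4 * π / (π - φ)) := by
  have hpi := Real.pi_pos
  have hd : 0 < π - φ := by linarith
  have key := aux_int_s10 (φ := φ) (c := 4) (by linarith) (by positivity)
    (fun ψ => 1 / Real.sqrt (Real.cos ψ - Real.cos φ))
    (fun ψ => -2 * Real.log (Real.sqrt (φ - ψ) + Real.sqrt (2*π - φ - ψ)))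
    (fun ψ => 1 / (Real.sqrt (φ - ψ) * Real.sqrt (2*π - φ - ψ)))
    ?_ ?_ (fun x _ => by positivity) (fun x => by positivity)
    (fun x => by simp only [Real.cos_neg]) ?_
  · refine key.trans ?_
    simp only [sub_self, Real.sqrt_zero, sub_neg_eq_add, zero_add]
    rw [show 2*π - φ + φ = 2*π by ring, show 2*π-φ-φ = 2*(π-φ) by ring, Real.log_sqrt (by linarith)]
    have h1 : Real.log (Real.sqrt (φ+φ) + Real.sqrt (2*π)) ≤ Real.log (8*π) / 2 := by
      rw [← Real.log_sqrt (by linarith)]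
      apply Real.log_le_log
      · have := Real.sqrt_pos.2 (show 0 < 2*π by linarith)
        positivity
      · have h3 : Real.sqrt (φ+φ) ≤ Real.sqrt (2*π) := Real.sqrt_le_sqrt (by linarith)
        have h4 : Real.sqrt (8*π) = 2 * Real.sqrt (2*π) := by
          rw [show 8*π = 2^2*(2*π) by ring, Real.sqrt_mul (by positivity),
            Real.sqrt_sq (by norm_num)]
        linarith
    have h5 : Real.log (4*π/(π-φ)) = Real.log (8*π) - Real.log (2*(π-φ)) := by
      rw [← Real.log_div (by positivity) (by positivity)]
      congr 1
      field_simp; norm_num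
    rw [h5]; linarith
  · refine continuousOn_const.mul (ContinuousOn.log (by fun_prop) ?_)
    intro x hx
    have := Real.sqrt_pos.2 (show 0 < 2*π - φ - x by linarith [hx.2])
    positivity
  · intro x hx
    have hs : 0 < φ - x := by linarith [hx.2]
    have hs2 : 0 < 2*π - φ - x := by linarith [hx.2]
    have p1 := Real.sqrt_pos.2 hs
    have p2 := Real.sqrt_pos.2 hs2
    have h := (((((hasDerivAt_id x).const_sub φ).sqrt hs.ne').add
      (((hasDerivAt_id x).const_sub (2*π-φ)).sqrt hs2.ne')).log (by
        simp only [id, Pi.add_apply]; positivity)).const_mul (-2)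
    refine h.congr_deriv ?_
    try simp only [id, Pi.add_apply]
    field_simp
    ring
  · rintro x ⟨hx0, hx1⟩
    have hs : 0 < φ - x := by linarith
    have hs2 : 0 < 2*π - φ - x := by linarith
    have hA : (2*π - φ - x)/(3*π) ≤ Real.sin ((φ + x)/2) := by
      rcases le_total ((φ+x)/2) (π/2) with h | h
      · refine le_trans ?_ (Real.mul_le_sin (by linarith) h)
        rw [div_le_iff₀ (by positivity)]; field_simp; linarith
      · rw [← Real.sin_pi_sub]
        refine le_trans ?_ (Real.mul_le_sin (by linarith) (by linarith))
        rw [div_le_iff₀ (by positivity)]; field_simp; linarith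
    have hB : (φ - x)/π ≤ Real.sin ((φ - x)/2) := by
      refine le_trans (le_of_eq ?_) (Real.mul_le_sin (by linarith) (by linarith))
      field_simp
    have hm : (φ-x)*(2*π-φ-x)/4^2 ≤ Real.cos x - Real.cos φ := by
      rw [cos_sub_prod]
      have := mul_le_mul hA hB (by positivity) ((by positivity : (0:ℝ) ≤ (2*π - φ - x)/(3*π)).trans hA)
      have hp : π^2 * 3 ≤ 32 := by nlinarith [Real.pi_lt_d2]
      calc _ ≤ 2 * ((2*π - φ - x)/(3*π) * ((φ-x)/π)) := by
            have e : 2 * ((2*π - φ - x)/(3*π) * ((φ-x)/π)) = (φ-x)*(2*π-φ-x) / (3*π^2/2) := by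
              field_simp
            rw [e]
            apply div_le_div_of_nonneg_left (by positivity) (by positivity)
            linarith
        _ ≤ _ := by linarith
    have hpos : 0 < (φ-x)*(2*π-φ-x)/4^2 := by positivity
    calc 1 / Real.sqrt (Real.cos x - Real.cos φ) ≤ 1 / Real.sqrt ((φ-x)*(2*π-φ-x)/4^2) :=
          one_div_le_one_div_of_le (Real.sqrt_pos.2 hpos) (Real.sqrt_le_sqrt hm)
      _ = _ := by
          rw [Real.sqrt_div (by positivity), Real.sqrt_sq (by norm_num), Real.sqrt_mul (by positivity)]
          have h1 : 0 < Real.sqrt (2*π-φ-x) := Real.sqrt_pos.2 hs2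
          have h2 : 0 < Real.sqrt (φ-x) := Real.sqrt_pos.2 hs
          field_simp

lemma case_two' {φ : ℝ} (hφ : φ < π) (h2 : π/2 ≤ φ) :
    ∫ ψ in (-φ)..φ, 1 / Real.sqrt (Real.cos ψ - Real.cos φ) ≤
      36 * Real.log (2 + 1 / (2 * (1 + Real.cos φ))) := by
  refine (case_two hφ h2).trans ?_
  have hpi := Real.pi_pos
  have hd : 0 < π - φ := by linarith
  have hc : 0 < 1 + Real.cos φ := by
    have := Real.cos_lt_cos_of_nonneg_of_le_pi (by linarith) le_rfl hφ
    rw [Real.cos_pi] at this; linarith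
  have hq : 2 * (1 + Real.cos φ) ≤ (π - φ)^2 := by
    have := Real.one_sub_sq_div_two_le_cos (x := π - φ)
    rw [Real.cos_pi_sub] at this; linarith
  set y := 1 / (2 * (1 + Real.cos φ)) with hy
  have hy0 : 0 < y := by positivity
  have hinv : (1/(π-φ))^2 ≤ y := by
    rw [div_pow, one_pow]
    exact one_div_le_one_div_of_le (by positivity) hq
  have hl : Real.log (4*π/(π-φ)) ≤ 4.5 * Real.log (2+y) := by
    have e1 : Real.log (4*π/(π-φ)) = Real.log (4*π) + Real.log (1/(π-φ)) := by
      rw [← Real.log_mul (by positivity) (by positivity)]; congr 1; ring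
    have e2 : Real.log (4*π) ≤ 4 * Real.log 2 := by
      have : (4:ℝ) * Real.log 2 = Real.log (2^4) := by rw [Real.log_pow]; norm_num
      rw [this]
      exact Real.log_le_log (by positivity) (by linarith [Real.pi_le_four])
    have e3 : 2 * Real.log (1/(π-φ)) ≤ Real.log (2+y) := by
      have : (2:ℝ) * Real.log (1/(π-φ)) = Real.log ((1/(π-φ))^2) := by rw [Real.log_pow]; norm_num
      rw [this]
      exact Real.log_le_log (by positivity) (by linarith)
    have e4 : Real.log 2 ≤ Real.log (2+y) := Real.log_le_log (by norm_num) (by linarith)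
    rw [e1]; linarith
  linarith

lemma case_pi : ∫ ψ in (-π)..π, 1 / Real.sqrt (Real.cos ψ - Real.cos π) = 0 := by
  apply intervalIntegral.integral_undef
  have hpi := Real.pi_pos
  refine not_intervalIntegrable_of_sub_inv_isBigO_punctured (c := π) ?_ (by linarith) (by simp)
  refine Asymptotics.IsBigO.of_bound 1 ?_
  have hm : ∀ᶠ x in nhdsWithin π {π}ᶜ, x ∈ Set.Ioo 0 (2*π) :=
    Filter.Eventually.filter_mono nhdsWithin_le_nhds (Ioo_mem_nhds hpi (by linarith))
  filter_upwards [hm, self_mem_nhdsWithin] with x hx hne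
  have hu : x - π ≠ 0 := sub_ne_zero.2 hne
  have e : Real.cos x - Real.cos π = 1 - Real.cos (x - π) := by
    rw [Real.cos_sub_pi, Real.cos_pi]; ring
  have hlt : Real.cos (x - π) ≠ 1 := fun h => hu
    ((Real.cos_eq_one_iff_of_lt_of_lt (by linarith [hx.1]) (by linarith [hx.2])).1 h)
  have hlt' : 0 < 1 - Real.cos (x - π) := by
    have := lt_of_le_of_ne (Real.cos_le_one (x-π)) hlt
    linarith
  have hb := Real.one_sub_sq_div_two_le_cos (x := x - π)
  rw [e, Real.norm_eq_abs, Real.norm_eq_abs, abs_of_nonneg (by positivity : (0:ℝ) ≤ 1 / Real.sqrt (1 - Real.cos (x-π))),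
    abs_inv, one_mul, ← one_div]
  apply one_div_le_one_div_of_le (Real.sqrt_pos.2 hlt')
  rw [← Real.sqrt_sq_eq_abs]
  exact Real.sqrt_le_sqrt (by nlinarith [sq_nonneg (x-π)])

/-- Kovalyov's estimate, case II: if `t ≤ |x| + r` and
`|(|x|² + r² − t²)/(2|x|r)| ≤ 1`, the angular integral `H(t,|x|,r)` (over
`[−φ, φ]` with `φ = arccos((|x|² + r² − t²)/(2|x|r))`) is bounded by
`(C/√(r|x|)) ln(2 + r|x| χ(t−|x|)/((r+|x|)² − t²))`.  (`R` stands for `|x|`.) -/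
theorem stmt_10 :
    ∃ C : ℝ, 0 < C ∧ ∀ t R r : ℝ, 0 < t → 0 < R → 0 < r →
      t ≤ R + r → |(R^2 + r^2 - t^2) / (2*R*r)| ≤ 1 →
      (∫ ψ in (-(Real.arccos ((R^2 + r^2 - t^2) / (2*R*r))))..(Real.arccos ((R^2 + r^2 - t^2) / (2*R*r))),
          1 / Real.sqrt (t^2 - R^2 - r^2 + 2*R*r*Real.cos ψ)) ≤
        (C / Real.sqrt (r*R)) *
          Real.log (2 + r*R * (if 0 < t - R then (1:ℝ) else 0) / ((r+R)^2 - t^2)) := by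
  refine ⟨36, by norm_num, ?_⟩
  intro t R r ht hR hr htr ha
  set a := (R^2 + r^2 - t^2) / (2*R*r) with hadef
  have hRr : 0 < R * r := mul_pos hR hr
  obtain ⟨ha1, ha2⟩ := abs_le.1 ha
  set φ := Real.arccos a with hφ
  have hcos : Real.cos φ = a := Real.cos_arccos ha1 ha2
  have h2a : 2*R*r*a = R^2 + r^2 - t^2 := by rw [hadef]; field_simp
  have hpi := Real.pi_pos
  have hl2 : (0.69:ℝ) < Real.log 2 := by linarith [Real.log_two_gt_d9]
  have hsq : 0 < Real.sqrt (r*R) := Real.sqrt_pos.2 (by positivity)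
  have hsq2 : Real.sqrt (r*R) ≤ Real.sqrt (2*R*r) := Real.sqrt_le_sqrt (by linarith)
  have hint : (∫ ψ in (-φ)..φ, 1 / Real.sqrt (t^2 - R^2 - r^2 + 2*R*r*Real.cos ψ)) =
      (1 / Real.sqrt (2*R*r)) * ∫ ψ in (-φ)..φ, 1 / Real.sqrt (Real.cos ψ - Real.cos φ) := by
    rw [← intervalIntegral.integral_const_mul]
    congr 1
    ext ψ
    rw [hcos, show t^2 - R^2 - r^2 + 2*R*r*Real.cos ψ = 2*R*r*(Real.cos ψ - a) by linarith,
      Real.sqrt_mul (by positivity), one_div_mul_one_div]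
  have hden : (r+R)^2 - t^2 = 2*R*r*(1+a) := by linarith
  have hI0 : 0 ≤ ∫ ψ in (-φ)..φ, 1 / Real.sqrt (Real.cos ψ - Real.cos φ) := by
    apply intervalIntegral.integral_nonneg (by linarith [Real.arccos_nonneg a])
    intro x _
    positivity
  have hlog : Real.log 2 ≤ Real.log (2 + r*R * (if 0 < t - R then (1:ℝ) else 0) / ((r+R)^2 - t^2)) := by
    apply Real.log_le_log (by norm_num)
    have : 0 ≤ r*R * (if 0 < t - R then (1:ℝ) else 0) / ((r+R)^2 - t^2) := by
      rw [hden]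
      apply div_nonneg
      · split_ifs <;> positivity
      · have : 0 ≤ 1 + a := by linarith
        positivity
    linarith
  suffices h : (∫ ψ in (-φ)..φ, 1 / Real.sqrt (Real.cos ψ - Real.cos φ)) ≤
      36 * Real.log (2 + r*R * (if 0 < t - R then (1:ℝ) else 0) / ((r+R)^2 - t^2)) by
    rw [hint]
    calc _ ≤ (1 / Real.sqrt (r*R)) * ∫ ψ in (-φ)..φ, 1 / Real.sqrt (Real.cos ψ - Real.cos φ) :=
          mul_le_mul_of_nonneg_right (one_div_le_one_div_of_le hsq hsq2) hI0
      _ ≤ (1 / Real.sqrt (r*R)) * _ := mul_le_mul_of_nonneg_left h (by positivity)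
      _ = _ := by ring
  rcases le_or_gt φ (π/2) with h1 | h1
  · rcases (Real.arccos_nonneg a).eq_or_lt with h0 | h0
    · have : φ = 0 := h0.symm
      rw [this]
      simp only [neg_zero, intervalIntegral.integral_same]
      linarith
    · have := case_one h0 h1
      linarith [Real.pi_lt_d2]
  · rcases (Real.arccos_le_pi a).eq_or_lt with h0 | h0
    · have : φ = π := h0
      rw [this, case_pi]
      linarith
    · have hneg : a < 0 := by
        rw [← hcos]
        exact Real.cos_neg_of_pi_div_two_lt_of_lt h1 (by linarith)
      have htR : 0 < t - R := by
        by_contra hcon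
        have : t^2 ≤ R^2 := by nlinarith
        have : 2*R*r*a < 0 := mul_neg_of_pos_of_neg (by positivity) hneg
        nlinarith
      have ha3 : 0 < 1 + a := by
        have := Real.cos_lt_cos_of_nonneg_of_le_pi (Real.arccos_nonneg a) le_rfl h0
        rw [Real.cos_pi, ← hφ, hcos] at this; linarith
      have hk := case_two' h0 h1.le
      rw [hcos] at hk ⊢
      rw [if_pos htR, hden]
      have : r*R*1/(2*R*r*(1+a)) = 1/(2*(1+a)) := by field_simp
      rw [this]
      exact hk
end
end
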